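/- arXiv:1711.00769 — 2 statements merged into one kernel-verified Lean document; each statement's English description precedes it below -/
import Mathlib

section
/- Suppose M₁ and M₂ are invariant subspaces of H²(𝔻ⁿ) with M₁ ⊆ M₂, where M₁ has finite codimension in H²(𝔻ⁿ). If L is a closed subspace of M₁ such that the orthogonal projection P^{M₂}_L of M₂ onto L belongs to T(M₂), then the orthogonal projection P^{M₁}_L of M₁ onto L belongs to T(M₁). -/
open ContinuousLinearMap

/-- The `C^*`-algebra generated by a set `R` of operators on a Hilbert space `E`:
the operator-norm closure of the star subalgebra generated by `R`. -/
noncomputable def genCStar {E : Type*} [NormedAddCommGroup E] [InnerProductSpace ℂ E]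
    [CompleteSpace E] (R : Set (E →L[ℂ] E)) : Set (E →L[ℂ] E) :=
  ((StarAlgebra.adjoin ℂ R).topologicalClosure : Set (E →L[ℂ] E))

/-- The Hardy space `H²(𝔻ⁿ)` realized as `ℓ²` over multi-indices `Fin n → ℕ`. -/
abbrev PolyHardy (n : ℕ) : Type := lp (fun _ : Fin n → ℕ => ℂ) 2

/-- The compression `P_S T|_S` of an operator `T` on `H²(𝔻ⁿ)` to a closed subspace `S`. -/
noncomputable def compressS {n : ℕ} (S : Submodule ℂ (PolyHardy n))
    (hS : IsClosed (S : Set (PolyHardy n))) (T : PolyHardy n →L[ℂ] PolyHardy n) :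
    ↥S →L[ℂ] ↥S :=
  haveI : CompleteSpace ↥S := hS.completeSpace_coe
  Submodule.orthogonalProjectionOnto S ∘L (T ∘L S.subtypeL)

/-- The restriction `T|_S : S → S` of an operator `T` leaving `S` invariant. -/
noncomputable def restrictS {n : ℕ} (S : Submodule ℂ (PolyHardy n))
    (T : PolyHardy n →L[ℂ] PolyHardy n) (h : ∀ x ∈ S, T x ∈ S) : ↥S →L[ℂ] ↥S :=
  ContinuousLinearMap.codRestrict (T ∘L S.subtypeL) S fun x => h x x.2

/-- The orthogonal projection of `H²(𝔻ⁿ)` onto a closed subspace `S`, as an operator on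
`H²(𝔻ⁿ)`. -/
noncomputable def projFull {n : ℕ} (S : Submodule ℂ (PolyHardy n))
    (hS : IsClosed (S : Set (PolyHardy n))) : PolyHardy n →L[ℂ] PolyHardy n :=
  haveI : CompleteSpace ↥S := hS.completeSpace_coe
  S.subtypeL ∘L Submodule.orthogonalProjectionOnto S

/-- The adjoint of an operator on a closed subspace `S` of `H²(𝔻ⁿ)`. -/
noncomputable def adjS {n : ℕ} (S : Submodule ℂ (PolyHardy n))
    (hS : IsClosed (S : Set (PolyHardy n))) (T : ↥S →L[ℂ] ↥S) : ↥S →L[ℂ] ↥S :=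
  haveI : CompleteSpace ↥S := hS.completeSpace_coe
  ContinuousLinearMap.adjoint T

/-- The `C^*`-algebra `T(S) ⊆ B(S)` generated by operators `R i` on a closed subspace `S`. -/
noncomputable def TalgGen {n : ℕ} (S : Submodule ℂ (PolyHardy n))
    (hS : IsClosed (S : Set (PolyHardy n))) (R : Fin n → (↥S →L[ℂ] ↥S)) :
    Set (↥S →L[ℂ] ↥S) :=
  haveI : CompleteSpace ↥S := hS.completeSpace_coe
  genCStar (Set.range R)

/-- The `C^*`-algebra `T(H²(𝔻ⁿ))` generated by the coordinate shifts. -/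
noncomputable def TalgFull {n : ℕ} (Mz : Fin n → (PolyHardy n →L[ℂ] PolyHardy n)) :
    Set (PolyHardy n →L[ℂ] PolyHardy n) :=
  genCStar (Set.range Mz)

/-- The orthogonal projection of `M` onto a closed subspace `L ⊆ M`, as an operator on `M`. -/
noncomputable def projNested {n : ℕ} (L M : Submodule ℂ (PolyHardy n))
    (hL : IsClosed (L : Set (PolyHardy n))) (hLM : L ≤ M) : ↥M →L[ℂ] ↥M :=
  haveI : CompleteSpace ↥L := hL.completeSpace_coe
  ContinuousLinearMap.codRestrict ((L.subtypeL ∘L Submodule.orthogonalProjectionOnto L) ∘L M.subtypeL) M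
    fun _ => hLM (SetLike.coe_mem _)


open InnerProductSpace

section FiniteRank

variable {E F G : Type*} [NormedAddCommGroup E] [InnerProductSpace ℂ E]
  [NormedAddCommGroup F] [InnerProductSpace ℂ F] [NormedAddCommGroup G] [InnerProductSpace ℂ G]

/-- A bounded operator has finite rank if it takes values in a finite-dimensional subspace. -/
def IsFiniteRank (T : E →L[ℂ] F) : Prop :=
  ∃ W : Submodule ℂ F, FiniteDimensional ℂ W ∧ ∀ x, T x ∈ W

namespace IsFiniteRank

theorem zero : IsFiniteRank (0 : E →L[ℂ] F) :=
  ⟨⊥, inferInstance, fun _ => by simp⟩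

theorem add {S T : E →L[ℂ] F} (hS : IsFiniteRank S) (hT : IsFiniteRank T) :
    IsFiniteRank (S + T) := by
  obtain ⟨V, _, hV⟩ := hS
  obtain ⟨W, _, hW⟩ := hT
  exact ⟨V ⊔ W, inferInstance, fun x => Submodule.add_mem_sup (hV x) (hW x)⟩

theorem neg {T : E →L[ℂ] F} (hT : IsFiniteRank T) : IsFiniteRank (-T) := by
  obtain ⟨W, hfin, hW⟩ := hT
  exact ⟨W, hfin, fun x => W.neg_mem (hW x)⟩

theorem comp_right {T : F →L[ℂ] G} (hT : IsFiniteRank T) (S : E →L[ℂ] F) :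
    IsFiniteRank (T ∘L S) := by
  obtain ⟨W, hfin, hW⟩ := hT
  exact ⟨W, hfin, fun x => hW (S x)⟩

theorem comp_left {T : E →L[ℂ] F} (hT : IsFiniteRank T) (S : F →L[ℂ] G) :
    IsFiniteRank (S ∘L T) := by
  obtain ⟨W, _, hW⟩ := hT
  exact ⟨W.map (S : F →ₗ[ℂ] G), inferInstance, fun x => Submodule.mem_map_of_mem (hW x)⟩

theorem eq_sum_rankOne [CompleteSpace E] [CompleteSpace F] {T : E →L[ℂ] F}
    (hT : IsFiniteRank T) :
    ∃ (m : ℕ) (b : Fin m → F), T = ∑ i, rankOne ℂ (b i) (adjoint T (b i)) := by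
  obtain ⟨W, _, hW⟩ := hT
  let b := stdOrthonormalBasis ℂ W
  refine ⟨_, fun i => (b i : F), ?_⟩
  ext x
  have h := congrArg (Subtype.val) (b.sum_repr' ⟨T x, hW x⟩)
  simp only [Submodule.coe_sum, Submodule.coe_smul, Submodule.coe_inner] at h
  simp [adjoint_inner_left, h]

protected theorem adjoint [CompleteSpace E] [CompleteSpace F] {T : E →L[ℂ] F}
    (hT : IsFiniteRank T) : IsFiniteRank (ContinuousLinearMap.adjoint T) := by
  obtain ⟨m, b, hb⟩ := hT.eq_sum_rankOne
  refine ⟨Submodule.span ℂ (Set.range fun i => adjoint T (b i)),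
    FiniteDimensional.span_of_finite ℂ (Set.finite_range _), fun x => ?_⟩
  have h : adjoint T = ∑ i, rankOne ℂ (adjoint T (b i)) (b i) := by
    conv_lhs => rw [hb]
    simp [map_sum]
  have hx : adjoint T x = ∑ i, inner ℂ (b i) x • adjoint T (b i) := by
    conv_lhs => rw [h]
    simp
  rw [hx]
  exact Submodule.sum_mem _ fun i _ => Submodule.smul_mem _ _ (Submodule.subset_span ⟨i, rfl⟩)

end IsFiniteRank

/-- In an irreducible operator algebra, a finite rank element `A` of minimal rank
satisfies `A B A ∈ ℂ A`. -/
theorem exists_mul_mul_eq_smul [CompleteSpace E] (𝒜 : StarSubalgebra ℂ (E →L[ℂ] E))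
    {A : E →L[ℂ] E} (hA : A ∈ 𝒜) (hA0 : A ≠ 0) (hfr : IsFiniteRank A)
    (hmin : ∀ C ∈ 𝒜, C ≠ 0 → IsFiniteRank C →
      Module.finrank ℂ (LinearMap.range (A : E →ₗ[ℂ] E)) ≤
        Module.finrank ℂ (LinearMap.range (C : E →ₗ[ℂ] E)))
    {B : E →L[ℂ] E} (hB : B ∈ 𝒜) : ∃ c : ℂ, A * B * A = c • A := by
  set V := LinearMap.range (A : E →ₗ[ℂ] E) with hV
  have hfin : FiniteDimensional ℂ V := by
    obtain ⟨W, _, hW⟩ := hfr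
    exact Submodule.finiteDimensional_of_le (S₂ := W) (by rintro _ ⟨x, rfl⟩; exact hW x)
  have hnt : Nontrivial V := by
    obtain ⟨x, hx⟩ : ∃ x, A x ≠ 0 := by
      by_contra! h
      exact hA0 (ContinuousLinearMap.ext h)
    exact ⟨⟨⟨A x, x, rfl⟩, 0, fun h => hx (congrArg Subtype.val h)⟩⟩
  let f : V →ₗ[ℂ] V := ((A * B : E →L[ℂ] E) : E →ₗ[ℂ] E).restrict
    (p := V) (q := V) (fun x _ => ⟨B x, rfl⟩)
  obtain ⟨c, hc⟩ := Module.End.exists_eigenvalue f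
  refine ⟨c, ?_⟩
  by_contra hne
  have hC0 : A * B * A - c • A ≠ 0 := sub_ne_zero.mpr hne
  have hCV : ∀ x, (A * B * A - c • A) x ∈ V := fun x =>
    V.sub_mem ⟨B (A x), rfl⟩ (V.smul_mem _ ⟨x, rfl⟩)
  have hle := hmin _ (sub_mem (mul_mem (mul_mem hA hB) hA) (𝒜.smul_mem hA c)) hC0
    ⟨V, hfin, hCV⟩
  let g : V →ₗ[ℂ] V := f - c • LinearMap.id
  have hsub : LinearMap.range ((A * B * A - c • A : E →L[ℂ] E) : E →ₗ[ℂ] E) ≤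
      (LinearMap.range g).map V.subtype := by
    rintro _ ⟨x, rfl⟩
    exact ⟨g ⟨A x, x, rfl⟩, ⟨_, rfl⟩, rfl⟩
  have h1 := Submodule.finrank_mono hsub
  have h2 : Module.finrank ℂ ((LinearMap.range g).map V.subtype) =
      Module.finrank ℂ (LinearMap.range g) :=
    Submodule.finrank_map_subtype_eq _ _
  have h3 := LinearMap.finrank_range_add_finrank_ker g
  have h4 : 0 < Module.finrank ℂ (LinearMap.ker g) := by
    obtain ⟨w, hw⟩ := hc.exists_hasEigenvector
    have : Nontrivial (LinearMap.ker g) :=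
      ⟨⟨⟨w, by simp [g, hw.apply_eq_smul]⟩, 0, fun h => hw.2 (congrArg Subtype.val h)⟩⟩
    exact Module.finrank_pos
  omega

/-- A closed irreducible star algebra of operators that contains a nonzero finite rank operator
contains all finite rank operators. -/
theorem mem_of_isFiniteRank [CompleteSpace E] (𝒜 : StarSubalgebra ℂ (E →L[ℂ] E))
    (hcl : IsClosed (𝒜 : Set (E →L[ℂ] E)))
    (hirr : ∀ x : E, x ≠ 0 → Dense {y | ∃ A ∈ 𝒜, A x = y})
    (hex : ∃ A ∈ 𝒜, A ≠ 0 ∧ IsFiniteRank A) {T : E →L[ℂ] E} (hT : IsFiniteRank T) :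
    T ∈ 𝒜 := by
  obtain ⟨A, ⟨hA, hA0, hfr⟩, hmin⟩ :=
    exists_minimalFor_of_wellFoundedLT (fun A : E →L[ℂ] E => A ∈ 𝒜 ∧ A ≠ 0 ∧ IsFiniteRank A)
      (fun A => Module.finrank ℂ (LinearMap.range (A : E →ₗ[ℂ] E))) hex
  have hscal : ∀ B ∈ 𝒜, ∃ c : ℂ, A * B * A = c • A := fun B hB =>
    exists_mul_mul_eq_smul 𝒜 hA hA0 hfr
      (fun C h1 h2 h3 => (le_total _ _).elim id (fun h => hmin ⟨h1, h2, h3⟩ h)) hB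
  obtain ⟨x₀, hx₀⟩ : ∃ x, A x ≠ 0 := by
    by_contra! h
    exact hA0 (ContinuousLinearMap.ext h)
  set u := A x₀ with hu
  have hspan : ∀ y, A y ∈ Submodule.span ℂ {u} := by
    have hclosed : IsClosed {y | A y ∈ Submodule.span ℂ {u}} :=
      (Submodule.closed_of_finiteDimensional (Submodule.span ℂ {u})).preimage A.continuous
    have hsub : {y | ∃ B ∈ 𝒜, B u = y} ⊆ {y | A y ∈ Submodule.span ℂ {u}} := by
      rintro _ ⟨B, hB, rfl⟩
      obtain ⟨c, hc⟩ := hscal B hB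
      exact Submodule.mem_span_singleton.mpr ⟨c, (congrArg (fun S => S x₀) hc).symm⟩
    intro y
    exact hclosed.closure_subset_iff.mpr hsub (hirr u hx₀ y)
  obtain ⟨v, hv⟩ : ∃ v, A = rankOne ℂ u v := by
    refine ⟨((inner ℂ u u)⁻¹ : ℂ) • adjoint A u, ?_⟩
    ext y
    obtain ⟨c, hc⟩ := Submodule.mem_span_singleton.mp (hspan y)
    have huu : inner ℂ u u ≠ 0 := inner_self_ne_zero.mpr hx₀
    simp only [rankOne_apply, inner_smul_left, adjoint_inner_left, map_inv₀, inner_conj_symm]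
    rw [← hc, inner_smul_right, mul_comm c, inv_mul_cancel_left₀ huu]
  have hv0 : v ≠ 0 := by
    rintro rfl
    simp [hv] at hA0
  have h1 : ∀ x, rankOne ℂ x v ∈ 𝒜 := by
    have hclosed : IsClosed {x | rankOne ℂ x v ∈ 𝒜} :=
      hcl.preimage (f := fun x => rankOne ℂ x v) (by fun_prop)
    have hsub : {y | ∃ B ∈ 𝒜, B u = y} ⊆ {x | rankOne ℂ x v ∈ 𝒜} := by
      rintro _ ⟨B, hB, rfl⟩
      have := mul_mem hB hA
      rwa [hv, ContinuousLinearMap.mul_def, comp_rankOne] at this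
    intro y
    exact hclosed.closure_subset_iff.mpr hsub (hirr u hx₀ y)
  have h2 : ∀ x y, rankOne ℂ x y ∈ 𝒜 := by
    intro x
    have hclosed : IsClosed {y | rankOne ℂ x y ∈ 𝒜} :=
      hcl.preimage (f := fun y => rankOne ℂ x y) (by fun_prop)
    have hsub : {y | ∃ B ∈ 𝒜, B v = y} ⊆ {y | rankOne ℂ x y ∈ 𝒜} := by
      rintro _ ⟨B, hB, rfl⟩
      have := mul_mem (h1 x) (star_mem hB)
      rwa [ContinuousLinearMap.mul_def, rankOne_comp, star_eq_adjoint, adjoint_adjoint] at this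
    intro y
    exact hclosed.closure_subset_iff.mpr hsub (hirr v hv0 y)
  obtain ⟨m, b, hb⟩ := hT.eq_sum_rankOne
  rw [hb]
  exact sum_mem fun i _ => h2 _ _

/-- The operators `A` and `B` are intertwined by `ι` up to a finite rank operator. -/
def AlmostIntertwined (ι : E →L[ℂ] F) (A : E →L[ℂ] E) (B : F →L[ℂ] F) : Prop :=
  IsFiniteRank (ι ∘L A - B ∘L ι)

namespace AlmostIntertwined

variable {ι : E →L[ℂ] F} {A A' : E →L[ℂ] E} {B B' : F →L[ℂ] F}

theorem of_algebraMap (ι : E →L[ℂ] F) (c : ℂ) :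
    AlmostIntertwined ι (algebraMap ℂ _ c) (algebraMap ℂ _ c) := by
  have : ι ∘L (algebraMap ℂ (E →L[ℂ] E) c) - (algebraMap ℂ (F →L[ℂ] F) c) ∘L ι = 0 := by
    ext x
    simp [Algebra.algebraMap_eq_smul_one]
  rw [AlmostIntertwined, this]
  exact IsFiniteRank.zero

theorem add (h : AlmostIntertwined ι A B) (h' : AlmostIntertwined ι A' B') :
    AlmostIntertwined ι (A + A') (B + B') := by
  have := IsFiniteRank.add h h'
  rw [AlmostIntertwined]
  convert this using 1
  simp only [ContinuousLinearMap.comp_add, ContinuousLinearMap.add_comp]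
  abel

theorem neg (h : AlmostIntertwined ι A B) : AlmostIntertwined ι (-A) (-B) := by
  have := IsFiniteRank.neg h
  rw [AlmostIntertwined]
  convert this using 1
  simp only [ContinuousLinearMap.comp_neg, ContinuousLinearMap.neg_comp]
  abel

theorem sub (h : AlmostIntertwined ι A B) (h' : AlmostIntertwined ι A' B') :
    AlmostIntertwined ι (A - A') (B - B') := by
  simpa only [sub_eq_add_neg] using h.add h'.neg

theorem mul (h : AlmostIntertwined ι A B) (h' : AlmostIntertwined ι A' B') :
    AlmostIntertwined ι (A * A') (B * B') := by
  have := (IsFiniteRank.comp_right h A').add (IsFiniteRank.comp_left h' B)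
  rw [AlmostIntertwined]
  convert this using 1
  ext x
  simp

theorem star [CompleteSpace E] [CompleteSpace F] (hι : adjoint ι ∘L ι = 1)
    (hcod : IsFiniteRank (1 - ι ∘L adjoint ι)) (h : AlmostIntertwined ι A B) :
    AlmostIntertwined ι (star A) (star B) := by
  have h1 := ((IsFiniteRank.adjoint h).comp_right ι).comp_left ι
  have h2 := (hcod.comp_right (adjoint B ∘L ι)).neg
  rw [AlmostIntertwined]
  convert h1.add h2 using 1
  ext x
  have hx : adjoint ι (ι x) = x := congrArg (fun S => S x) hι
  simp [star_eq_adjoint, adjoint_comp, hx]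

theorem exists_of_mem_adjoin [CompleteSpace E] [CompleteSpace F] (hι : adjoint ι ∘L ι = 1)
    (hcod : IsFiniteRank (1 - ι ∘L adjoint ι)) {κ : Type*} {R : κ → E →L[ℂ] E}
    {S : κ → F →L[ℂ] F} (hRS : ∀ i, AlmostIntertwined ι (R i) (S i))
    (hB : B ∈ StarAlgebra.adjoin ℂ (Set.range S)) :
    ∃ A ∈ StarAlgebra.adjoin ℂ (Set.range R), AlmostIntertwined ι A B := by
  induction hB using StarAlgebra.adjoin_induction with
  | mem _ h =>
    obtain ⟨i, rfl⟩ := h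
    exact ⟨R i, StarAlgebra.subset_adjoin _ _ ⟨i, rfl⟩, hRS i⟩
  | algebraMap c => exact ⟨_, algebraMap_mem _ c, of_algebraMap ι c⟩
  | add _ _ _ _ h h' =>
    obtain ⟨A, hA, h⟩ := h
    obtain ⟨A', hA', h'⟩ := h'
    exact ⟨_, add_mem hA hA', h.add h'⟩
  | mul _ _ _ _ h h' =>
    obtain ⟨A, hA, h⟩ := h
    obtain ⟨A', hA', h'⟩ := h'
    exact ⟨_, mul_mem hA hA', h.mul h'⟩
  | star _ _ h =>
    obtain ⟨A, hA, h⟩ := h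
    exact ⟨_, star_mem hA, h.star hι hcod⟩

end AlmostIntertwined

end FiniteRank

section CoordinateShifts

variable {n : ℕ}

/-- `Mz` is the tuple of coordinate shifts on `H²(𝔻ⁿ)`. -/
def IsCoordShift (Mz : Fin n → (PolyHardy n →L[ℂ] PolyHardy n)) : Prop :=
  ∀ (i : Fin n) (f : PolyHardy n) (k : Fin n → ℕ),
    Mz i f k = if k i = 0 then 0 else f (Function.update k i (k i - 1))

/-- The formal power series of an element of `H²(𝔻ⁿ)`. -/
def hardyToPowerSeries : PolyHardy n →ₗ[ℂ] MvPowerSeries (Fin n) ℂ where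
  toFun f := fun k => f k
  map_add' _ _ := rfl
  map_smul' _ _ := rfl

theorem coeff_hardyToPowerSeries (f : PolyHardy n) (k : Fin n →₀ ℕ) :
    MvPowerSeries.coeff k (hardyToPowerSeries f) = f k := rfl

theorem hardyToPowerSeries_injective :
    Function.Injective (hardyToPowerSeries (n := n)) := by
  intro f g h
  ext k
  simpa [coeff_hardyToPowerSeries] using
    congrArg (MvPowerSeries.coeff (Finsupp.equivFunOnFinite.symm k)) h

theorem hardyToPowerSeries_single_zero :
    hardyToPowerSeries (lp.single 2 (0 : Fin n → ℕ) (1 : ℂ)) = 1 := by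
  ext k
  rw [coeff_hardyToPowerSeries, MvPowerSeries.coeff_one, lp.single_apply, Pi.single_apply]
  congr 1
  exact propext (by rw [← Finsupp.coe_zero, DFunLike.coe_fn_eq])

/-- Evaluation of a coefficient as a bounded functional. -/
noncomputable def hardyCoeff (k : Fin n → ℕ) : PolyHardy n →L[ℂ] ℂ :=
  innerSL ℂ (lp.single 2 k (1 : ℂ))

theorem hardyCoeff_apply (k : Fin n → ℕ) (f : PolyHardy n) : hardyCoeff k f = f k := by
  simp [hardyCoeff, lp.inner_single_left]

namespace IsCoordShift

variable {Mz : Fin n → (PolyHardy n →L[ℂ] PolyHardy n)}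

theorem hardyToPowerSeries_apply (hMz : IsCoordShift Mz) (i : Fin n) (f : PolyHardy n) :
    hardyToPowerSeries (Mz i f) = MvPowerSeries.X i * hardyToPowerSeries f := by
  classical
  ext k
  rw [coeff_hardyToPowerSeries, hMz, MvPowerSeries.X, MvPowerSeries.coeff_monomial_mul]
  simp only [Finsupp.single_le_iff, Nat.one_le_iff_ne_zero, ite_not, one_mul,
    coeff_hardyToPowerSeries]
  split_ifs with h
  · rfl
  · refine congrArg f (funext fun j => ?_)
    by_cases hj : j = i
    · subst hj; simp
    · simp [hj]

theorem commute (hMz : IsCoordShift Mz) (i j : Fin n) : Commute (Mz i) (Mz j) := by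
  refine ContinuousLinearMap.ext fun f => hardyToPowerSeries_injective ?_
  simp only [mul_apply_eq_comp, hMz.hardyToPowerSeries_apply]
  ring

theorem hardyToPowerSeries_aeval (hMz : IsCoordShift Mz) (i : Fin n) (q : Polynomial ℂ)
    (f : PolyHardy n) :
    hardyToPowerSeries (Polynomial.aeval (Mz i) q f) =
      Polynomial.aeval (MvPowerSeries.X i : MvPowerSeries (Fin n) ℂ) q * hardyToPowerSeries f := by
  induction q using Polynomial.induction_on' generalizing f with
  | add p q hp hq => simp [hp, hq, add_mul]
  | monomial m a =>
    induction m generalizing f with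
    | zero => simp [Algebra.algebraMap_eq_smul_one]
    | succ m ih =>
      have h := ih (Mz i f)
      simp only [Polynomial.aeval_monomial, mul_apply_eq_comp] at h ⊢
      rw [pow_succ, mul_apply_eq_comp, h, hMz.hardyToPowerSeries_apply]
      ring

theorem apply_single (hMz : IsCoordShift Mz) (i : Fin n) (k : Fin n → ℕ) :
    Mz i (lp.single 2 k (1 : ℂ)) = lp.single 2 (Function.update k i (k i + 1)) (1 : ℂ) := by
  ext m
  rw [hMz, lp.single_apply, lp.single_apply, Pi.single_apply, Pi.single_apply]
  by_cases hm : m i = 0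
  · rw [if_pos hm, if_neg]
    rintro rfl
    simp at hm
  · rw [if_neg hm]
    congr 1
    refine propext ⟨?_, ?_⟩
    · rintro rfl
      simp [Nat.sub_add_cancel (Nat.one_le_iff_ne_zero.mpr hm)]
    · rintro rfl
      simp

/-- An operator commuting with all coordinate shifts is multiplication by a power series. -/
theorem hardyToPowerSeries_of_commute (hMz : IsCoordShift Mz)
    {S : PolyHardy n →L[ℂ] PolyHardy n} (hS : ∀ i f, S (Mz i f) = Mz i (S f)) (g : PolyHardy n) :
    hardyToPowerSeries (S g) =
      hardyToPowerSeries (S (lp.single 2 (0 : Fin n → ℕ) (1 : ℂ))) * hardyToPowerSeries g := by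
  classical
  set φ := hardyToPowerSeries (S (lp.single 2 (0 : Fin n → ℕ) (1 : ℂ))) with hφ
  have hsingle : ∀ (d : ℕ) (k : Fin n → ℕ), ∑ i, k i = d →
      hardyToPowerSeries (S (lp.single 2 k (1 : ℂ))) =
        φ * hardyToPowerSeries (lp.single 2 k (1 : ℂ)) := by
    intro d
    induction d with
    | zero =>
      intro k hk
      obtain rfl : k = 0 := by
        ext i
        exact (Finset.sum_eq_zero_iff.mp hk) i (Finset.mem_univ i)
      rw [hardyToPowerSeries_single_zero, mul_one]
    | succ d ih =>
      intro k hk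
      obtain ⟨i, hi⟩ : ∃ i, k i ≠ 0 := by
        by_contra! h
        simp [h] at hk
      set k' := Function.update k i (k i - 1) with hk'
      have hkk : k = Function.update k' i (k' i + 1) := by
        simp [hk', Nat.sub_add_cancel (Nat.one_le_iff_ne_zero.mpr hi)]
      have hsum : ∑ j, k' j = d := by
        rw [← Finset.add_sum_erase _ _ (Finset.mem_univ i)] at hk ⊢
        have : ∑ j ∈ Finset.univ.erase i, k' j = ∑ j ∈ Finset.univ.erase i, k j :=
          Finset.sum_congr rfl fun j hj => by simp [hk', Finset.ne_of_mem_erase hj]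
        rw [this, hk', Function.update_self]
        omega
      rw [hkk, ← hMz.apply_single, hS, hMz.hardyToPowerSeries_apply, ih k' hsum,
        hMz.hardyToPowerSeries_apply]
      ring
  ext m
  have key : hardyCoeff (m : Fin n → ℕ) ∘L S =
      ∑ p ∈ Finset.HasAntidiagonal.antidiagonal m, MvPowerSeries.coeff p.1 φ • hardyCoeff (p.2 : Fin n → ℕ) := by
    refine lp.ext_continuousLinearMap (ENNReal.ofNat_ne_top (n := nat_lit 2)) fun k => ?_
    ext
    have := congrArg (MvPowerSeries.coeff m) (hsingle _ k rfl)
    rw [MvPowerSeries.coeff_mul] at this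
    simpa [hardyCoeff_apply, coeff_hardyToPowerSeries] using this
  have := congrArg (fun L => L g) key
  rw [MvPowerSeries.coeff_mul]
  simpa [hardyCoeff_apply, coeff_hardyToPowerSeries] using this

theorem adjoint_apply (hMz : IsCoordShift Mz) (i : Fin n) (f : PolyHardy n) (k : Fin n → ℕ) :
    adjoint (Mz i) f k = f (Function.update k i (k i + 1)) := by
  have h : hardyCoeff k (adjoint (Mz i) f) = hardyCoeff (Function.update k i (k i + 1)) f := by
    simp only [hardyCoeff, innerSL_apply_apply, adjoint_inner_right, hMz.apply_single]
  simpa only [hardyCoeff_apply] using h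

theorem star_mul_comm (hMz : IsCoordShift Mz) {i j : Fin n} (hij : i ≠ j) :
    star (Mz i) * Mz j = Mz j * star (Mz i) := by
  refine ContinuousLinearMap.ext fun f => lp.ext (funext fun k => ?_)
  simp only [mul_apply_eq_comp, star_eq_adjoint, hMz.adjoint_apply, hMz j,
    Function.update_of_ne hij, Function.update_of_ne hij.symm]
  split_ifs
  · rfl
  · exact congrArg f (Function.update_comm hij _ _ k)

theorem one_sub_mul_star_apply (hMz : IsCoordShift Mz) (i : Fin n) (f : PolyHardy n)
    (k : Fin n → ℕ) : (1 - Mz i * star (Mz i)) f k = if k i = 0 then f k else 0 := by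
  have : (1 - Mz i * star (Mz i)) f k = f k - Mz i (adjoint (Mz i) f) k := rfl
  rw [this, hMz, hMz.adjoint_apply]
  split_ifs with h
  · simp
  · simp [Nat.sub_add_cancel (Nat.one_le_iff_ne_zero.mpr h)]

theorem prod_one_sub_mul_star_apply (hMz : IsCoordShift Mz) (l : List (Fin n)) (f : PolyHardy n)
    (k : Fin n → ℕ) :
    (l.map fun i => 1 - Mz i * star (Mz i)).prod f k = if ∀ i ∈ l, k i = 0 then f k else 0 := by
  induction l with
  | nil => simp
  | cons i l ih =>
    rw [List.map_cons, List.prod_cons, mul_apply_eq_comp, hMz.one_sub_mul_star_apply,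
      ih]
    by_cases h : k i = 0 <;> simp [h]

theorem isFiniteRank_prod (hMz : IsCoordShift Mz) :
    IsFiniteRank (Finset.univ.toList.map fun i => 1 - Mz i * star (Mz i)).prod := by
  refine ⟨Submodule.span ℂ {lp.single 2 (0 : Fin n → ℕ) (1 : ℂ)}, inferInstance, fun f => ?_⟩
  refine Submodule.mem_span_singleton.mpr ⟨f 0, lp.ext (funext fun k => ?_)⟩
  rw [hMz.prod_one_sub_mul_star_apply]
  by_cases hk : k = 0
  · subst hk; simp
  · have h : ¬ ∀ i ∈ Finset.univ.toList, k i = 0 := fun h => hk (funext fun i => h i (by simp))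
    rw [if_neg h]
    simp [hk]

theorem aeval_X_ne_zero (i : Fin n) {q : Polynomial ℂ} (hq : q ≠ 0) :
    Polynomial.aeval (MvPowerSeries.X i : MvPowerSeries (Fin n) ℂ) q ≠ 0 := by
  intro h
  have h1 := (transcendental_iff.mp (MvPolynomial.transcendental_X ℂ i)) q
  refine hq (h1 (MvPolynomial.coe_injective _ _ ?_))
  have h2 := Polynomial.aeval_algHom_apply (MvPolynomial.coeToMvPowerSeries.algHom (R := ℂ) ℂ)
    (MvPolynomial.X i : MvPolynomial (Fin n) ℂ) q
  simp only [MvPolynomial.coeToMvPowerSeries.algHom_apply, MvPolynomial.coe_X,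
    MvPowerSeries.map_X, h] at h2
  simpa using h2.symm

end IsCoordShift

end CoordinateShifts

section InvariantSubspaces

theorem commute_aeval_right {A : Type*} [Semiring A] [Algebra ℂ A] {a b : A} (h : Commute a b)
    (q : Polynomial ℂ) : Commute a (Polynomial.aeval b q) := by
  induction q using Polynomial.induction_on' with
  | add p q hp hq => simpa using hp.add_right hq
  | monomial m c =>
    rw [Polynomial.aeval_monomial]
    exact Commute.mul_right (Algebra.commutes c a).symm (h.pow_right m)

theorem genCStar_eq_closure {E : Type*} [NormedAddCommGroup E] [InnerProductSpace ℂ E]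
    [CompleteSpace E] (R : Set (E →L[ℂ] E)) :
    genCStar R = closure (StarAlgebra.adjoin ℂ R : Set (E →L[ℂ] E)) := rfl

/-- `genCStar R` is the carrier of a closed star subalgebra containing `adjoin R`. -/
theorem exists_coe_eq_genCStar {E : Type*} [NormedAddCommGroup E] [InnerProductSpace ℂ E]
    [CompleteSpace E] (R : Set (E →L[ℂ] E)) :
    ∃ 𝒜 : StarSubalgebra ℂ (E →L[ℂ] E), (𝒜 : Set (E →L[ℂ] E)) = genCStar R ∧
      IsClosed (𝒜 : Set (E →L[ℂ] E)) ∧ StarAlgebra.adjoin ℂ R ≤ 𝒜 :=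
  ⟨_, rfl, StarSubalgebra.isClosed_topologicalClosure _, StarSubalgebra.le_topologicalClosure _⟩

theorem isFiniteRank_one_sub_comp_adjoint {E F : Type*} [NormedAddCommGroup E]
    [InnerProductSpace ℂ E] [NormedAddCommGroup F] [InnerProductSpace ℂ F] [CompleteSpace E]
    [CompleteSpace F] {ι : E →L[ℂ] F} (hι : adjoint ι ∘L ι = 1) (W : Submodule ℂ F)
    [hfin : FiniteDimensional ℂ W] (hW : ∀ y, (∀ x, inner ℂ (ι x) y = 0) → y ∈ W) :
    IsFiniteRank (1 - ι ∘L adjoint ι) := by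
  refine ⟨W, hfin, fun y => hW _ fun x => ?_⟩
  have hx : adjoint ι (ι (adjoint ι y)) = adjoint ι y := congrArg (fun S => S (adjoint ι y)) hι
  simp [← adjoint_inner_right, hx]

theorem adjoint_comp_eq_one {E F : Type*} [NormedAddCommGroup E]
    [InnerProductSpace ℂ E] [NormedAddCommGroup F] [InnerProductSpace ℂ F] [CompleteSpace E]
    [CompleteSpace F] {ι : E →L[ℂ] F} (h : ∀ x y, inner ℂ (ι x) (ι y) = inner ℂ x y) :
    adjoint ι ∘L ι = 1 := by
  ext x
  refine ext_inner_left ℂ fun y => ?_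
  simp [adjoint_inner_right, h]

variable {n : ℕ} {Mz : Fin n → (PolyHardy n →L[ℂ] PolyHardy n)}

/-- A finite-codimensional invariant subspace contains the range of a nonzero polynomial in any
of the shifts. -/
theorem exists_aeval_mem (M : Submodule ℂ (PolyHardy n)) [CompleteSpace M]
    [FiniteDimensional ℂ Mᗮ] {T : PolyHardy n →L[ℂ] PolyHardy n} (hinv : ∀ x ∈ M, T x ∈ M) :
    ∃ q : Polynomial ℂ, q ≠ 0 ∧ ∀ f, Polynomial.aeval T q f ∈ M := by
  have : FiniteDimensional ℂ (PolyHardy n ⧸ M) :=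
    (Submodule.quotientEquivOfIsCompl M Mᗮ M.isCompl_orthogonal).symm.finiteDimensional
  let Q : (PolyHardy n ⧸ M) →ₗ[ℂ] (PolyHardy n ⧸ M) :=
    M.mapQ M (T : PolyHardy n →ₗ[ℂ] PolyHardy n) hinv
  have key : ∀ (q : Polynomial ℂ) (f : PolyHardy n),
      M.mkQ (Polynomial.aeval T q f) = Polynomial.aeval Q q (M.mkQ f) := by
    intro q
    induction q using Polynomial.induction_on' with
    | add p q hp hq =>
      intro f
      rw [map_add, map_add, add_apply, map_add, hp, hq, LinearMap.add_apply]
    | monomial m a =>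
      induction m with
      | zero =>
        intro f
        simp [Algebra.algebraMap_eq_smul_one]
      | succ m ih =>
        intro f
        have h := ih (T f)
        have hT : M.mkQ (T f) = Q (M.mkQ f) := rfl
        rw [hT] at h
        simp only [Polynomial.aeval_monomial, mul_apply_eq_comp, Module.End.mul_apply] at h ⊢
        rw [pow_succ, mul_apply_eq_comp, h, pow_succ, Module.End.mul_apply]
  refine ⟨Q.charpoly, Q.charpoly_monic.ne_zero, fun f => ?_⟩
  have := key Q.charpoly f
  rw [Q.aeval_self_charpoly, LinearMap.zero_apply] at this
  exact (Submodule.Quotient.mk_eq_zero M).mp this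

theorem coe_aeval_restrictS {M : Submodule ℂ (PolyHardy n)}
    {T : PolyHardy n →L[ℂ] PolyHardy n} (hinv : ∀ x ∈ M, T x ∈ M) (q : Polynomial ℂ) (x : M) :
    ((Polynomial.aeval (restrictS M T hinv) q x : M) : PolyHardy n) =
      Polynomial.aeval T q (x : PolyHardy n) := by
  induction q using Polynomial.induction_on' generalizing x with
  | add p q hp hq => simp [hp, hq]
  | monomial m a =>
    induction m generalizing x with
    | zero => simp [Algebra.algebraMap_eq_smul_one]
    | succ m ih =>
      have h := ih (restrictS M T hinv x)
      have hT : ((restrictS M T hinv x : M) : PolyHardy n) = T x := rfl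
      rw [hT] at h
      simp only [Polynomial.aeval_monomial, mul_apply_eq_comp] at h ⊢
      rw [pow_succ, mul_apply_eq_comp, h, pow_succ, mul_apply_eq_comp]

namespace IsCoordShift

variable {M : Submodule ℂ (PolyHardy n)}

/-- The restrictions of the shifts to an invariant subspace of finite codimension have no
nontrivial idempotents in their commutant. -/
theorem eq_zero_or_eq_one_of_commute (hMz : IsCoordShift Mz) (hinv : ∀ i, ∀ x ∈ M, Mz i x ∈ M)
    [CompleteSpace M] [FiniteDimensional ℂ Mᗮ] (i₀ : Fin n) {Q : M →L[ℂ] M} (hQ : Q * Q = Q)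
    (hcomm : ∀ i, Commute Q (restrictS M (Mz i) (hinv i))) : Q = 0 ∨ Q = 1 := by
  obtain ⟨q, hq0, hq⟩ := exists_aeval_mem M (hinv i₀)
  set T := Polynomial.aeval (Mz i₀) q with hT
  set t := Polynomial.aeval (MvPowerSeries.X i₀ : MvPowerSeries (Fin n) ℂ) q with ht
  have ht0 : t ≠ 0 := aeval_X_ne_zero i₀ hq0
  have hTps : ∀ f, hardyToPowerSeries (T f) = t * hardyToPowerSeries f :=
    hMz.hardyToPowerSeries_aeval i₀ q
  let T' : PolyHardy n →L[ℂ] M := T.codRestrict M hq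
  let S : PolyHardy n →L[ℂ] PolyHardy n := M.subtypeL ∘L Q ∘L T'
  have hS : ∀ i f, S (Mz i f) = Mz i (S f) := by
    intro i f
    have h1 : T' (Mz i f) = restrictS M (Mz i) (hinv i) (T' f) := by
      refine Subtype.ext ?_
      have : Commute T (Mz i) := by
        rw [hT]
        exact (commute_aeval_right (hMz.commute i i₀) q).symm
      exact congrArg (fun L => L f) this
    have h2 := congrArg (fun L => ((L (T' f) : M) : PolyHardy n)) (hcomm i)
    simp only [S, ContinuousLinearMap.comp_apply, h1]
    exact h2
  have hmul := hMz.hardyToPowerSeries_of_commute hS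
  set δ : PolyHardy n := lp.single 2 (0 : Fin n → ℕ) (1 : ℂ) with hδ
  set φ := hardyToPowerSeries (S δ) with hφ
  have hTM : ∀ x : M, T' x = Polynomial.aeval (restrictS M (Mz i₀) (hinv i₀)) q x := fun x =>
    Subtype.ext (coe_aeval_restrictS (hinv i₀) q x).symm
  have hQT : ∀ x : M, S x = T (Q x) := by
    intro x
    have hc : Commute Q (Polynomial.aeval (restrictS M (Mz i₀) (hinv i₀)) q) :=
      commute_aeval_right (hcomm i₀) q
    have h := congrArg (fun L => ((L x : M) : PolyHardy n)) hc
    simp only [mul_apply_eq_comp, ← hTM] at h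
    exact h
  have hrel : ∀ x : M, t * hardyToPowerSeries (Q x : PolyHardy n) =
      φ * hardyToPowerSeries (x : PolyHardy n) := fun x => by
    rw [← hTps, ← hQT, hmul]
  have hφφ : t * φ = φ * φ := by
    have h := hrel (Q (T' δ))
    have hQQ : Q (Q (T' δ)) = Q (T' δ) := congrArg (fun L => L (T' δ)) hQ
    rw [hQQ] at h
    exact h
  rcases eq_or_ne φ 0 with h0 | h0
  · left
    ext1 x
    refine Subtype.ext (hardyToPowerSeries_injective ?_)
    have h := hrel x
    rw [h0, zero_mul] at h
    simpa using (mul_eq_zero.mp h).resolve_left ht0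
  · right
    have htφ : t = φ := mul_right_cancel₀ h0 hφφ
    ext1 x
    refine Subtype.ext (hardyToPowerSeries_injective ?_)
    have h := hrel x
    rw [← htφ] at h
    exact mul_left_cancel₀ ht0 h

theorem ne_bot_of_finiteDimensional_orthogonal (hMz : IsCoordShift Mz) (hinv : ∀ i, ∀ x ∈ M, Mz i x ∈ M)
    [CompleteSpace M] [FiniteDimensional ℂ Mᗮ] (i₀ : Fin n) : M ≠ ⊥ := by
  rintro rfl
  obtain ⟨q, hq0, hq⟩ := exists_aeval_mem ⊥ (hinv i₀)
  have h := hMz.hardyToPowerSeries_aeval i₀ q (lp.single 2 (0 : Fin n → ℕ) (1 : ℂ))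
  rw [(Submodule.mem_bot ℂ).mp (hq _), hardyToPowerSeries_single_zero, mul_one, map_zero] at h
  exact aeval_X_ne_zero i₀ hq0 h.symm

theorem dense_orbit (hMz : IsCoordShift Mz) (hinv : ∀ i, ∀ x ∈ M, Mz i x ∈ M)
    [CompleteSpace M] [FiniteDimensional ℂ Mᗮ] (i₀ : Fin n) {𝒜 : StarSubalgebra ℂ (M →L[ℂ] M)}
    (h𝒜 : ∀ i, restrictS M (Mz i) (hinv i) ∈ 𝒜) {x : M} (hx : x ≠ 0) :
    Dense {y | ∃ A ∈ 𝒜, A x = y} := by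
  let O : Submodule ℂ M :=
    { carrier := {y | ∃ A ∈ 𝒜, A x = y}
      add_mem' := by
        rintro _ _ ⟨A, hA, rfl⟩ ⟨B, hB, rfl⟩
        exact ⟨A + B, add_mem hA hB, rfl⟩
      zero_mem' := ⟨0, zero_mem _, rfl⟩
      smul_mem' := by
        rintro c _ ⟨A, hA, rfl⟩
        exact ⟨c • A, 𝒜.smul_mem hA c, rfl⟩ }
  let K := O.topologicalClosure
  have : CompleteSpace K := O.isClosed_topologicalClosure.completeSpace_coe
  have hKinv : ∀ A ∈ 𝒜, ∀ y ∈ K, A y ∈ K := by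
    intro A hA y hy
    refine map_mem_closure A.continuous hy ?_
    rintro _ ⟨B, hB, rfl⟩
    exact ⟨A * B, mul_mem hA hB, rfl⟩
  have hKperp : ∀ A ∈ 𝒜, ∀ y ∈ Kᗮ, A y ∈ Kᗮ := by
    intro A hA y hy
    rw [Submodule.mem_orthogonal] at hy ⊢
    intro u hu
    rw [← adjoint_inner_left, ← star_eq_adjoint]
    exact hy _ (hKinv _ (star_mem hA) u hu)
  have hcomm : ∀ i, Commute K.starProjection (restrictS M (Mz i) (hinv i)) := by
    intro i
    refine ContinuousLinearMap.ext fun y => ?_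
    set R := restrictS M (Mz i) (hinv i)
    change K.starProjection (R y) = R (K.starProjection y)
    refine (Submodule.eq_starProjection_of_mem_orthogonal
      (hKinv _ (h𝒜 i) _ (K.starProjection_apply_mem y)) ?_)
    rw [← map_sub]
    exact hKperp _ (h𝒜 i) _ (K.sub_starProjection_mem_orthogonal y)
  have hxK : x ∈ K := O.le_topologicalClosure ⟨1, one_mem _, rfl⟩
  have hKtop : K = ⊤ := by
    rcases hMz.eq_zero_or_eq_one_of_commute hinv i₀ K.isIdempotentElem_starProjection hcomm
      with h | h
    · refine absurd ?_ hx
      rw [← Submodule.starProjection_eq_self_iff.mpr hxK, h, zero_apply]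
    · refine Submodule.eq_top_iff'.mpr fun y => ?_
      rw [← Submodule.starProjection_eq_self_iff, h, one_apply_eq_self]
  exact Submodule.dense_iff_topologicalClosure_eq_top.mpr hKtop

/-- An invariant subspace on which the shifts doubly commute has nonzero defect operator. -/
theorem prod_one_sub_mul_star_ne_zero (hMz : IsCoordShift Mz)
    (hinv : ∀ i, ∀ x ∈ M, Mz i x ∈ M) [CompleteSpace M] (hM : M ≠ ⊥)
    (hdc : ∀ i j, i ≠ j → Commute (star (restrictS M (Mz i) (hinv i)))
      (restrictS M (Mz j) (hinv j))) {l : List (Fin n)} (hl : l.Nodup) :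
    (l.map fun i => 1 - restrictS M (Mz i) (hinv i) * star (restrictS M (Mz i) (hinv i))).prod
      ≠ 0 := by
  set R := fun i => restrictS M (Mz i) (hinv i) with hR
  have hRR : ∀ i j, Commute (R i) (R j) := fun i j =>
    ContinuousLinearMap.ext fun x =>
      Subtype.ext (congrArg (fun L => L (x : PolyHardy n)) (hMz.commute i j))
  induction l with
  | nil =>
    have : Nontrivial M := Submodule.nontrivial_iff_ne_bot.mpr hM
    simp
  | cons i l ih =>
    intro h0
    rw [List.nodup_cons] at hl
    refine ih hl.2 ?_
    set X := (l.map fun i => 1 - R i * star (R i)).prod with hX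
    have hcX : Commute (star (R i)) X := by
      refine Commute.list_prod_right _ _ fun Y hY => ?_
      obtain ⟨j, hj, rfl⟩ := List.mem_map.mp hY
      have hij : i ≠ j := fun h => hl.1 (h ▸ hj)
      exact (Commute.one_right _).sub_right ((hdc i j hij).mul_right (hRR i j).star_star)
    rw [List.map_cons, List.prod_cons, sub_mul, one_mul, sub_eq_zero] at h0
    have hfix : ∀ f, X f = R i (X (star (R i) f)) := by
      intro f
      have h1 : X f = R i (star (R i) (X f)) := congrArg (fun L => L f) h0
      have h2 : star (R i) (X f) = X (star (R i) f) := congrArg (fun L => L f) hcX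
      rw [h1, h2]
    have hcoef : ∀ (m : ℕ) (k : Fin n → ℕ) (f : M), k i = m → (X f : PolyHardy n) k = 0 := by
      intro m
      induction m with
      | zero =>
        intro k f hk
        rw [hfix f]
        exact (hMz i _ k).trans (if_pos hk)
      | succ m ihm =>
        intro k f hk
        rw [hfix f]
        refine (hMz i _ k).trans ((if_neg (by omega)).trans (ihm _ _ ?_))
        simp [hk]
    ext f k
    exact hcoef _ k f rfl

theorem exists_isFiniteRank_mem (hMz : IsCoordShift Mz) (hinv : ∀ i, ∀ x ∈ M, Mz i x ∈ M)
    [CompleteSpace M] [hfin : FiniteDimensional ℂ Mᗮ] (i₀ : Fin n)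
    {𝒜 : StarSubalgebra ℂ (M →L[ℂ] M)} (h𝒜 : ∀ i, restrictS M (Mz i) (hinv i) ∈ 𝒜) :
    ∃ A ∈ 𝒜, A ≠ 0 ∧ IsFiniteRank A := by
  by_contra! hcon
  have hι : adjoint M.subtypeL ∘L M.subtypeL = 1 := adjoint_comp_eq_one fun _ _ => rfl
  have hcod : IsFiniteRank (1 - M.subtypeL ∘L adjoint M.subtypeL) :=
    isFiniteRank_one_sub_comp_adjoint hι Mᗮ fun y hy =>
      (Submodule.mem_orthogonal _ _).mpr fun u hu => hy ⟨u, hu⟩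
  have hzero : ∀ A ∈ 𝒜, ∀ B, AlmostIntertwined M.subtypeL A B → IsFiniteRank B → A = 0 := by
    intro A hA B hAB hB
    by_contra hne
    refine hcon A hA hne ?_
    convert (IsFiniteRank.add hAB (hB.comp_right M.subtypeL)).comp_left (adjoint M.subtypeL)
      using 1
    rw [sub_add_cancel, ← ContinuousLinearMap.comp_assoc, hι]
    rfl
  set R := fun i => restrictS M (Mz i) (hinv i) with hR
  have hint : ∀ i, AlmostIntertwined M.subtypeL (R i) (Mz i) := by
    intro i
    have : M.subtypeL ∘L R i - Mz i ∘L M.subtypeL = 0 := sub_eq_zero.mpr rfl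
    rw [AlmostIntertwined, this]
    exact IsFiniteRank.zero
  have hints : ∀ i, AlmostIntertwined M.subtypeL (star (R i)) (star (Mz i)) := fun i =>
    (hint i).star hι hcod
  have hdc : ∀ i j, i ≠ j → Commute (star (R i)) (R j) := by
    intro i j hij
    refine sub_eq_zero.mp (hzero _ (sub_mem (mul_mem (star_mem (h𝒜 i)) (h𝒜 j))
      (mul_mem (h𝒜 j) (star_mem (h𝒜 i)))) _
      (((hints i).mul (hint j)).sub ((hint j).mul (hints i))) ?_)
    rw [hMz.star_mul_comm hij, sub_self]
    exact IsFiniteRank.zero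
  have hone : AlmostIntertwined M.subtypeL 1 1 := by
    simpa using AlmostIntertwined.of_algebraMap M.subtypeL 1
  have hprod : ∀ l : List (Fin n), AlmostIntertwined M.subtypeL
      (l.map fun i => 1 - R i * star (R i)).prod (l.map fun i => 1 - Mz i * star (Mz i)).prod := by
    intro l
    induction l with
    | nil => simpa using hone
    | cons i l ih =>
      simp only [List.map_cons, List.prod_cons]
      exact (hone.sub ((hint i).mul (hints i))).mul ih
  refine hMz.prod_one_sub_mul_star_ne_zero hinv
    (hMz.ne_bot_of_finiteDimensional_orthogonal hinv i₀) hdc (Finset.nodup_toList Finset.univ)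
    (hzero _ (list_prod_mem fun Y hY => ?_) _ (hprod _) hMz.isFiniteRank_prod)
  obtain ⟨j, -, rfl⟩ := List.mem_map.mp hY
  exact sub_mem (one_mem _) (mul_mem (h𝒜 j) (star_mem (h𝒜 j)))

end IsCoordShift

end InvariantSubspaces

/-- If `M₁ ⊆ M₂` are invariant subspaces of `H²(𝔻ⁿ)`, `M₁` of finite codimension, and `L` is
a closed subspace of `M₁` with `P^{M₂}_L ∈ T(M₂)`, then `P^{M₁}_L ∈ T(M₁)`. -/
theorem stmt16 {n : ℕ} (hn : 2 ≤ n)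
    (Mz : Fin n → (PolyHardy n →L[ℂ] PolyHardy n))
    (hMz : ∀ (i : Fin n) (f : PolyHardy n) (k : Fin n → ℕ),
      Mz i f k = if k i = 0 then 0 else f (Function.update k i (k i - 1)))
    (M₁ M₂ : Submodule ℂ (PolyHardy n)) (h12 : M₁ ≤ M₂)
    (hM₁ : IsClosed (M₁ : Set (PolyHardy n))) (hM₂ : IsClosed (M₂ : Set (PolyHardy n)))
    (hinv₁ : ∀ (i : Fin n), ∀ x ∈ M₁, Mz i x ∈ M₁)
    (hinv₂ : ∀ (i : Fin n), ∀ x ∈ M₂, Mz i x ∈ M₂)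
    (hcodim : FiniteDimensional ℂ ↥M₁ᗮ)
    (L : Submodule ℂ (PolyHardy n)) (hL : IsClosed (L : Set (PolyHardy n))) (hLM₁ : L ≤ M₁)
    (hP2 : projNested L M₂ hL (hLM₁.trans h12)
      ∈ TalgGen M₂ hM₂ (fun i => restrictS M₂ (Mz i) (hinv₂ i))) :
    projNested L M₁ hL hLM₁ ∈ TalgGen M₁ hM₁ (fun i => restrictS M₁ (Mz i) (hinv₁ i)) := by
  have hMz' : IsCoordShift Mz := hMz
  have i₀ : Fin n := ⟨0, by omega⟩
  have : CompleteSpace M₁ := hM₁.completeSpace_coe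
  have : CompleteSpace M₂ := hM₂.completeSpace_coe
  set R := fun i => restrictS M₁ (Mz i) (hinv₁ i) with hR
  set S := fun i => restrictS M₂ (Mz i) (hinv₂ i) with hS
  obtain ⟨𝒜, h𝒜, hcl, hle⟩ := exists_coe_eq_genCStar (Set.range R)
  replace hP2 : projNested L M₂ hL (hLM₁.trans h12) ∈
      closure (StarAlgebra.adjoin ℂ (Set.range S) : Set (M₂ →L[ℂ] M₂)) := by
    rw [← genCStar_eq_closure]
    exact hP2
  change projNested L M₁ hL hLM₁ ∈ genCStar (Set.range R)
  rw [← h𝒜, SetLike.mem_coe]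
  have hR𝒜 : ∀ i, R i ∈ 𝒜 := fun i => hle (StarAlgebra.subset_adjoin _ _ ⟨i, rfl⟩)
  have hfr : ∀ T : M₁ →L[ℂ] M₁, IsFiniteRank T → T ∈ 𝒜 := fun T hT =>
    mem_of_isFiniteRank 𝒜 hcl (fun x hx => hMz'.dense_orbit hinv₁ i₀ hR𝒜 hx)
      (hMz'.exists_isFiniteRank_mem hinv₁ i₀ hR𝒜) hT
  let ι : M₁ →L[ℂ] M₂ := M₁.subtypeL.codRestrict M₂ fun x => h12 x.2
  have hι : adjoint ι ∘L ι = 1 := adjoint_comp_eq_one fun _ _ => rfl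
  have hcod : IsFiniteRank (1 - ι ∘L adjoint ι) := by
    have : FiniteDimensional ℂ (M₁ᗮ.comap M₂.subtype) :=
      Module.Finite.of_injective
        (M₂.subtype.restrict (p := M₁ᗮ.comap M₂.subtype) (q := M₁ᗮ) fun _ h => h)
        fun x y h => Subtype.ext (Subtype.ext (congrArg (fun z : M₁ᗮ => (z : PolyHardy n)) h))
    exact isFiniteRank_one_sub_comp_adjoint hι (M₁ᗮ.comap M₂.subtype) fun y hy =>
      (Submodule.mem_orthogonal _ _).mpr fun u hu => hy ⟨u, hu⟩
  have hRS : ∀ i, AlmostIntertwined ι (R i) (S i) := by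
    intro i
    have : ι ∘L R i - S i ∘L ι = 0 := sub_eq_zero.mpr rfl
    rw [AlmostIntertwined, this]
    exact IsFiniteRank.zero
  have hcompress : ∀ B ∈ StarAlgebra.adjoin ℂ (Set.range S), adjoint ι ∘L B ∘L ι ∈ 𝒜 := by
    intro B hB
    obtain ⟨A, hA, hAB⟩ := AlmostIntertwined.exists_of_mem_adjoin hι hcod hRS hB
    have h := sub_mem (hle hA) (hfr _ (IsFiniteRank.comp_left hAB (adjoint ι)))
    convert h using 1
    rw [ContinuousLinearMap.comp_sub, ← ContinuousLinearMap.comp_assoc (adjoint ι) ι A, hι,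
      ContinuousLinearMap.one_def, ContinuousLinearMap.id_comp, sub_sub_cancel]
  have hcont : Continuous fun B : M₂ →L[ℂ] M₂ => adjoint ι ∘L B ∘L ι := by fun_prop
  have hmem := hcl.closure_subset (map_mem_closure hcont hP2 hcompress)
  suffices h : projNested L M₁ hL hLM₁ = adjoint ι ∘L projNested L M₂ hL (hLM₁.trans h12) ∘L ι by
    rw [h]
    exact hmem
  have hproj : ι ∘L projNested L M₁ hL hLM₁ = projNested L M₂ hL (hLM₁.trans h12) ∘L ι := rfl
  rw [← hproj, ← ContinuousLinearMap.comp_assoc, hι, ContinuousLinearMap.one_def,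
    ContinuousLinearMap.id_comp]
end

section
/- If S is an invariant subspace of finite codimension in H²(𝔻ⁿ), then T(S) and T(H²(𝔻ⁿ)) are unitarily equivalent: there exists a unitary operator (linear isometric isomorphism) U : S → H²(𝔻ⁿ) such that { U ∘ T ∘ U⁻¹ : T ∈ T(S) } = T(H²(𝔻ⁿ)) as subsets of B(H²(𝔻ⁿ)). -/
open ContinuousLinearMap

section Irreducible

variable {E : Type*} [NormedAddCommGroup E] [InnerProductSpace ℂ E] [CompleteSpace E]

open InnerProductSpace (rankOne)

/-- The orbit `B v` of a vector under a star algebra of operators. -/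
noncomputable def orbit (B : StarSubalgebra ℂ (E →L[ℂ] E)) (v : E) : Submodule ℂ E :=
  B.toSubalgebra.toSubmodule.map (ContinuousLinearMap.apply ℂ E v).toLinearMap

lemma mem_orbit {B : StarSubalgebra ℂ (E →L[ℂ] E)} {v x : E} :
    x ∈ orbit B v ↔ ∃ b ∈ B, b v = x := by
  simp [orbit]

lemma orbit_dense {B : StarSubalgebra ℂ (E →L[ℂ] E)}
    (hirr : ∀ P : E →L[ℂ] E, P * P = P → (∀ b ∈ B, P * b = b * P) → P = 0 ∨ P = 1)
    {v : E} (hv : v ≠ 0) : Dense (orbit B v : Set E) := by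
  set K := (orbit B v).topologicalClosure with hK
  have hKc : IsClosed (K : Set E) := Submodule.isClosed_topologicalClosure _
  have : CompleteSpace K := hKc.completeSpace_coe
  have hsub : (orbit B v : Set E) ⊆ K := Submodule.le_topologicalClosure _
  have hinv : ∀ b ∈ B, ∀ x ∈ K, b x ∈ K := by
    intro b hb x hx
    have : Set.MapsTo b (closure (orbit B v : Set E)) (closure (orbit B v : Set E)) := by
      refine Set.MapsTo.closure ?_ b.continuous
      rintro _ hy
      obtain ⟨c, hc, rfl⟩ := mem_orbit.1 hy
      exact mem_orbit.2 ⟨b * c, mul_mem hb hc, rfl⟩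
    exact this hx
  have hperp : ∀ b ∈ B, ∀ x ∈ Kᗮ, b x ∈ Kᗮ := by
    intro b hb x hx y hy
    rw [← adjoint_inner_left]
    exact hx _ (hinv _ (star_mem hb) y hy)
  have hvK : v ∈ K := hsub (mem_orbit.2 ⟨1, one_mem _, rfl⟩)
  rcases hirr K.starProjection K.isIdempotentElem_starProjection (fun b hb => by
    ext x
    change K.starProjection (b x) = b (K.starProjection x)
    refine Submodule.eq_starProjection_of_mem_orthogonal (K := K) ?_ ?_
    · exact hinv b hb _ (K.starProjection_apply_mem x)
    · have := hperp b hb _ (K.sub_starProjection_mem_orthogonal x)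
      simpa using this) with h | h
  · have := Submodule.starProjection_eq_self_iff.2 hvK
    rw [h] at this
    exact absurd this.symm hv
  · intro x
    have : x ∈ K := Submodule.starProjection_eq_self_iff.1 (by rw [h]; rfl)
    exact this

/-- An element of minimal positive rank in an irreducible star algebra has rank one. -/
lemma exists_rankOne_mem {B : StarSubalgebra ℂ (E →L[ℂ] E)}
    (hirr : ∀ P : E →L[ℂ] E, P * P = P → (∀ b ∈ B, P * b = b * P) → P = 0 ∨ P = 1)
    (hfin : ∃ a ∈ B, a ≠ 0 ∧ FiniteDimensional ℂ a.range) :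
    ∃ u v : E, u ≠ 0 ∧ v ≠ 0 ∧ rankOne ℂ u v ∈ B := by
  classical
  have hex : ∃ r : ℕ, ∃ a ∈ B, a ≠ 0 ∧ FiniteDimensional ℂ a.range ∧
      Module.finrank ℂ a.range = r := by
    obtain ⟨a, h1, h2, h3⟩ := hfin
    exact ⟨_, a, h1, h2, h3, rfl⟩
  obtain ⟨a, haB, ha0, hafd, har⟩ := Nat.find_spec hex
  have hmin : ∀ c ∈ B, FiniteDimensional ℂ c.range →
      Module.finrank ℂ c.range < Module.finrank ℂ a.range → c = 0 := by
    intro c hc hcf hlt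
    by_contra h0
    rw [har] at hlt
    exact Nat.find_min hex hlt ⟨c, hc, h0, hcf, rfl⟩
  obtain ⟨x, hx⟩ : ∃ x, a x ≠ 0 := by
    by_contra! h
    exact ha0 (ContinuousLinearMap.ext h)
  have key : ∀ b ∈ B, ∃ l : ℂ, a * b * a = l • a := by
    intro b hb
    let T : Module.End ℂ a.range :=
      ((a * b : E →L[ℂ] E) : E →ₗ[ℂ] E).restrict (p := a.range) (q := a.range)
        (fun y _ => ⟨b y, rfl⟩)
    have : Nontrivial a.range := ⟨⟨⟨a x, x, rfl⟩, 0, fun h => hx (congrArg Subtype.val h)⟩⟩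
    obtain ⟨l, hl⟩ := Module.End.exists_eigenvalue T
    obtain ⟨⟨w, hw⟩, hwe⟩ := hl.exists_hasEigenvector
    have hw0 : w ≠ 0 := fun h => hwe.2 (Subtype.ext h)
    have hwl : a (b w) = l • w := congrArg Subtype.val hwe.apply_eq_smul
    refine ⟨l, sub_eq_zero.1 ?_⟩
    let g : E →ₗ[ℂ] E := ((a * b - l • 1 : E →L[ℂ] E) : E →ₗ[ℂ] E)
    have hc : a * b * a - l • a = (a * b - l • 1) * a := by
      rw [sub_mul, smul_mul_assoc, one_mul]
    have hrange : (a * b * a - l • a).range = a.range.map g := by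
      rw [hc]
      exact LinearMap.range_comp _ _
    have hfd : FiniteDimensional ℂ (a.range.map g) := inferInstance
    refine hmin _ (sub_mem (mul_mem (mul_mem haB hb) haB) (B.smul_mem haB l)) ?_ ?_
    · rw [hrange]; exact hfd
    · rw [hrange]
      have h1 := LinearMap.finrank_range_add_finrank_ker (g.domRestrict a.range)
      have h2 : (g.domRestrict a.range).range = a.range.map g := LinearMap.range_domRestrict ..
      rw [h2] at h1
      have h3 : 0 < Module.finrank ℂ (LinearMap.ker (g.domRestrict a.range)) := by
        have : Nontrivial (LinearMap.ker (g.domRestrict a.range)) := by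
          refine ⟨⟨⟨⟨w, hw⟩, ?_⟩, 0, fun h => hw0 ?_⟩⟩
          · simp [g, hwl]
          · exact congrArg Subtype.val (congrArg Subtype.val h)
        exact Module.finrank_pos
      omega
  have hspan : ∀ y, a y ∈ Submodule.span ℂ {a x} := by
    have hcl : IsClosed {y | a y ∈ Submodule.span ℂ {a x}} :=
      (Submodule.closed_of_finiteDimensional (Submodule.span ℂ {a x})).preimage a.continuous
    intro y
    refine (hcl.closure_subset_iff.2 ?_) ((orbit_dense hirr hx) y)
    intro z hz
    obtain ⟨b, hb, rfl⟩ := mem_orbit.1 hz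
    obtain ⟨l, hl⟩ := key b hb
    exact Submodule.mem_span_singleton.2 ⟨l, (congrArg (fun t : E →L[ℂ] E => t x) hl).symm⟩
  have hform : a = rankOne ℂ (a x) ((((‖a x‖ : ℂ) ^ 2)⁻¹) • adjoint a (a x)) := by
    ext y
    obtain ⟨l, hl⟩ := Submodule.mem_span_singleton.1 (hspan y)
    have hne : (‖a x‖ : ℂ) ≠ 0 := by simpa using hx
    rw [InnerProductSpace.rankOne_apply, inner_smul_left, adjoint_inner_left, ← hl, inner_smul_right,
      inner_self_eq_norm_sq_to_K]
    congr 1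
    simp
    field_simp
  refine ⟨_, _, hx, ?_, hform ▸ haB⟩
  intro h
  rw [h, map_zero] at hform
  exact ha0 hform

/-- A norm-closed irreducible star algebra of operators containing a nonzero finite-rank operator
contains every rank-one operator. -/
lemma rankOne_mem_of_irreducible {B : StarSubalgebra ℂ (E →L[ℂ] E)}
    (hB : IsClosed (B : Set (E →L[ℂ] E)))
    (hirr : ∀ P : E →L[ℂ] E, P * P = P → (∀ b ∈ B, P * b = b * P) → P = 0 ∨ P = 1)
    (hfin : ∃ a ∈ B, a ≠ 0 ∧ FiniteDimensional ℂ a.range) (x y : E) :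
    rankOne ℂ x y ∈ B := by
  obtain ⟨u, v, hu, hv, huv⟩ := exists_rankOne_mem hirr hfin
  have h1 : ∀ y, rankOne ℂ u y ∈ B := by
    intro y
    have hcl : IsClosed {y | rankOne ℂ u y ∈ B} :=
      hB.preimage (rankOne ℂ (E := E) (F := E) u).continuous
    refine (hcl.closure_subset_iff.2 ?_) ((orbit_dense hirr hv) y)
    intro z hz
    obtain ⟨b, hb, rfl⟩ := mem_orbit.1 hz
    have := mul_mem huv (star_mem hb)
    rw [ContinuousLinearMap.mul_def, InnerProductSpace.rankOne_comp] at this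
    rwa [star_eq_adjoint, adjoint_adjoint] at this
  have hcl : IsClosed {x | rankOne ℂ x y ∈ B} := by
    have h2 : IsClosed {x | star (rankOne ℂ y x) ∈ B} :=
      hB.preimage (continuous_star.comp (rankOne ℂ (E := E) (F := E) y).continuous)
    simpa [star_eq_adjoint] using h2
  refine (hcl.closure_subset_iff.2 ?_) ((orbit_dense hirr hu) x)
  intro z hz
  obtain ⟨b, hb, rfl⟩ := mem_orbit.1 hz
  have := mul_mem hb (h1 y)
  rwa [ContinuousLinearMap.mul_def, InnerProductSpace.comp_rankOne] at this

lemma eq_sum_rankOne (T : E →L[ℂ] E) [FiniteDimensional ℂ T.range] :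
    T = ∑ i, rankOne ℂ (stdOrthonormalBasis ℂ T.range i : E)
      (adjoint T (stdOrthonormalBasis ℂ T.range i : E)) := by
  ext x
  have := congrArg Subtype.val ((stdOrthonormalBasis ℂ T.range).sum_repr' ⟨T x, x, rfl⟩)
  simp only [sum_apply, InnerProductSpace.rankOne_apply, adjoint_inner_left]
  simpa using this.symm

lemma mem_of_finiteDimensional_range {B : StarSubalgebra ℂ (E →L[ℂ] E)}
    (hB : ∀ x y, rankOne ℂ x y ∈ B) (T : E →L[ℂ] E) (hT : FiniteDimensional ℂ T.range) :
    T ∈ B := by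
  rw [eq_sum_rankOne T]
  exact sum_mem fun i _ => hB _ _

end Irreducible

section Shift

open InnerProductSpace (rankOne)

variable {n : ℕ}

/-- The monomial `z ^ k`. -/
noncomputable def mono (k : Fin n → ℕ) : PolyHardy n := lp.single 2 k (1 : ℂ)

lemma mono_apply (k m : Fin n → ℕ) : mono k m = if m = k then (1 : ℂ) else 0 := by
  simp [mono, lp.single_apply, Pi.single_apply]

lemma inner_mono (k : Fin n → ℕ) (f : PolyHardy n) : inner ℂ (mono k) f = f k := by
  simp [mono, lp.inner_single_left]

lemma continuous_coeff (k : Fin n → ℕ) : Continuous fun f : PolyHardy n => f k := by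
  simp_rw [← inner_mono]
  exact (innerSL ℂ (mono k)).continuous

lemma norm_mono (k : Fin n → ℕ) : ‖(mono k : PolyHardy n)‖ = 1 := by
  simp [mono, lp.norm_single]

lemma eq_top_of_mono_mem {K : Submodule ℂ (PolyHardy n)} (hK : IsClosed (K : Set (PolyHardy n)))
    (h : ∀ k, mono k ∈ K) : K = ⊤ := by
  refine eq_top_iff.2 fun f _ => ?_
  refine hK.mem_of_tendsto (lp.hasSum_single (by simp) f) (Filter.Eventually.of_forall fun s => ?_)
  refine sum_mem fun k _ => ?_
  have : lp.single 2 k (f k) = f k • (mono k : PolyHardy n) := by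
    rw [mono, ← lp.single_smul, smul_eq_mul, mul_one]
  rw [this]
  exact K.smul_mem _ (h k)

variable {Mz : Fin n → (PolyHardy n →L[ℂ] PolyHardy n)}

lemma shift_pow_apply (hMz : ∀ (i : Fin n) (f : PolyHardy n) (k : Fin n → ℕ),
      Mz i f k = if k i = 0 then 0 else f (Function.update k i (k i - 1)))
    (i : Fin n) (N : ℕ) (f : PolyHardy n) (k : Fin n → ℕ) :
    (Mz i ^ N) f k = if k i < N then 0 else f (Function.update k i (k i - N)) := by
  induction N generalizing k with
  | zero => simp
  | succ N ih =>
    rw [pow_succ', mul_apply_eq_comp, hMz]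
    split_ifs with h1 h2 h2
    · rfl
    · omega
    · rw [ih, if_pos (by simp; omega)]
    · rw [ih, if_neg (by simp; omega)]
      simp [Nat.sub_sub, add_comm]

lemma shift_pow_mono (hMz : ∀ (i : Fin n) (f : PolyHardy n) (k : Fin n → ℕ),
      Mz i f k = if k i = 0 then 0 else f (Function.update k i (k i - 1)))
    (i : Fin n) (N : ℕ) (k : Fin n → ℕ) :
    (Mz i ^ N) (mono k) = mono (Function.update k i (k i + N)) := by
  ext m
  rw [shift_pow_apply hMz, mono_apply, mono_apply]
  by_cases h : m i < N
  · rw [if_pos h, if_neg]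
    rintro rfl
    simp at h
  · rw [if_neg h]
    congr 1
    rw [eq_iff_iff, Function.update_eq_iff, Function.eq_update_iff]
    refine and_congr ⟨fun h => by omega, fun h => by omega⟩ Iff.rfl

lemma shift_mono (hMz : ∀ (i : Fin n) (f : PolyHardy n) (k : Fin n → ℕ),
      Mz i f k = if k i = 0 then 0 else f (Function.update k i (k i - 1)))
    (i : Fin n) (k : Fin n → ℕ) :
    Mz i (mono k) = mono (Function.update k i (k i + 1)) := by
  simpa using shift_pow_mono hMz i 1 k

lemma adjoint_shift_pow_apply (hMz : ∀ (i : Fin n) (f : PolyHardy n) (k : Fin n → ℕ),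
      Mz i f k = if k i = 0 then 0 else f (Function.update k i (k i - 1)))
    (i : Fin n) (N : ℕ) (f : PolyHardy n) (k : Fin n → ℕ) :
    star (Mz i ^ N) f k = f (Function.update k i (k i + N)) := by
  rw [← inner_mono, star_eq_adjoint, adjoint_inner_right, shift_pow_mono hMz, inner_mono]

lemma star_shift_mul_shift (hMz : ∀ (i : Fin n) (f : PolyHardy n) (k : Fin n → ℕ),
      Mz i f k = if k i = 0 then 0 else f (Function.update k i (k i - 1))) (i : Fin n) :
    star (Mz i) * Mz i = 1 := by
  ext f k
  rw [← pow_one (Mz i), mul_apply_eq_comp, adjoint_shift_pow_apply hMz,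
    shift_pow_apply hMz]
  simp

lemma shift_commute (hMz : ∀ (i : Fin n) (f : PolyHardy n) (k : Fin n → ℕ),
      Mz i f k = if k i = 0 then 0 else f (Function.update k i (k i - 1))) (i j : Fin n) :
    Commute (Mz i) (Mz j) := by
  rcases eq_or_ne i j with rfl | hij
  · rfl
  ext f k
  simp only [mul_apply_eq_comp, hMz, Function.update_of_ne hij,
    Function.update_of_ne hij.symm]
  split_ifs <;> first | rfl | rw [Function.update_comm hij]

lemma box_apply (hMz : ∀ (i : Fin n) (f : PolyHardy n) (k : Fin n → ℕ),
      Mz i f k = if k i = 0 then 0 else f (Function.update k i (k i - 1)))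
    (i : Fin n) (N : ℕ) (f : PolyHardy n) (k : Fin n → ℕ) :
    (1 - Mz i ^ N * star (Mz i ^ N)) f k = if k i < N then f k else 0 := by
  change f k - (Mz i ^ N) (star (Mz i ^ N) f) k = _
  rw [shift_pow_apply hMz, adjoint_shift_pow_apply hMz]
  split_ifs with h
  · simp
  · simp [Nat.sub_add_cancel (not_lt.1 h)]

lemma box_list_apply (hMz : ∀ (i : Fin n) (f : PolyHardy n) (k : Fin n → ℕ),
      Mz i f k = if k i = 0 then 0 else f (Function.update k i (k i - 1)))
    (l : List (Fin n)) (N : ℕ) (f : PolyHardy n) (k : Fin n → ℕ) :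
    (l.map fun i => 1 - Mz i ^ N * star (Mz i ^ N)).prod f k =
      if ∀ i ∈ l, k i < N then f k else 0 := by
  induction l with
  | nil => simp
  | cons i l ih =>
    rw [List.map_cons, List.prod_cons, mul_apply_eq_comp, box_apply hMz, ih]
    simp only [List.forall_mem_cons]
    split_ifs <;> first | rfl | tauto

lemma finiteDimensional_range_box (hMz : ∀ (i : Fin n) (f : PolyHardy n) (k : Fin n → ℕ),
      Mz i f k = if k i = 0 then 0 else f (Function.update k i (k i - 1))) (N : ℕ) :
    FiniteDimensional ℂ
      ((List.finRange n).map fun i => 1 - Mz i ^ N * star (Mz i ^ N)).prod.range := by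
  classical
  let box : Finset (Fin n → ℕ) := Fintype.piFinset fun _ => Finset.range N
  have hfd : FiniteDimensional ℂ (Submodule.span ℂ ((box.image mono : Finset (PolyHardy n)) :
    Set (PolyHardy n))) := FiniteDimensional.span_finset _ _
  refine Submodule.finiteDimensional_of_le (S₂ := Submodule.span ℂ
    ((box.image mono : Finset (PolyHardy n)) : Set (PolyHardy n))) ?_
  rintro _ ⟨f, rfl⟩
  have : ((List.finRange n).map fun i => 1 - Mz i ^ N * star (Mz i ^ N)).prod f
      = ∑ k ∈ box, f k • mono k := by
    ext m
    rw [box_list_apply hMz, lp.coeFn_sum, Finset.sum_apply]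
    simp [mono_apply, box]
  rw [ContinuousLinearMap.coe_coe, this]
  exact sum_mem fun k hk => Submodule.smul_mem _ _
    (Submodule.subset_span (Finset.mem_coe.2 (Finset.mem_image_of_mem _ hk)))

lemma norm_star_shift_pow_le (hMz : ∀ (i : Fin n) (f : PolyHardy n) (k : Fin n → ℕ),
      Mz i f k = if k i = 0 then 0 else f (Function.update k i (k i - 1))) (i : Fin n) (N : ℕ) :
    ‖star (Mz i ^ N)‖ ≤ 1 := by
  have h1 (f : PolyHardy n) : ‖(Mz i ^ N) f‖ = ‖f‖ := by
    induction N with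
    | zero => rfl
    | succ N ih =>
      rw [pow_succ', mul_apply_eq_comp,
        (norm_map_iff_adjoint_comp_self (Mz i)).2 (star_shift_mul_shift hMz i), ih]
  rw [star_eq_adjoint, LinearIsometryEquiv.norm_map]
  exact ContinuousLinearMap.opNorm_le_bound _ zero_le_one fun f => by rw [h1, one_mul]

/-- The adjoint of a coordinate shift is pure. -/
lemma tendsto_star_shift_pow (hMz : ∀ (i : Fin n) (f : PolyHardy n) (k : Fin n → ℕ),
      Mz i f k = if k i = 0 then 0 else f (Function.update k i (k i - 1))) (i : Fin n)
    (f : PolyHardy n) :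
    Filter.Tendsto (fun N => star (Mz i ^ N) f) Filter.atTop (nhds 0) := by
  let K : Submodule ℂ (PolyHardy n) :=
    { carrier := {f | Filter.Tendsto (fun N => star (Mz i ^ N) f) Filter.atTop (nhds 0)}
      add_mem' := fun ha hb => by simpa using Filter.Tendsto.add ha hb
      zero_mem' := by simp
      smul_mem' := fun c x hx => by
        have := Filter.Tendsto.const_smul hx c
        rw [smul_zero] at this
        exact this.congr fun N => (map_smul _ _ _).symm }
  have hK : IsClosed (K : Set (PolyHardy n)) := by
    refine isClosed_of_closure_subset fun g hg => Metric.tendsto_atTop.2 fun ε hε => ?_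
    obtain ⟨h, hh, hgh⟩ := Metric.mem_closure_iff.1 hg (ε / 2) (by positivity)
    obtain ⟨N₀, hN₀⟩ := Metric.tendsto_atTop.1 (show Filter.Tendsto _ _ _ from hh) (ε / 2)
      (by positivity)
    refine ⟨N₀, fun N hN => ?_⟩
    have h1 := hN₀ N hN
    rw [dist_zero_right] at h1 ⊢
    have h2 : ‖star (Mz i ^ N) (g - h)‖ ≤ dist g h := by
      rw [dist_eq_norm]
      exact (le_of_opNorm_le _ (norm_star_shift_pow_le hMz i N) _).trans_eq (one_mul _)
    have h3 : star (Mz i ^ N) g = star (Mz i ^ N) (g - h) + star (Mz i ^ N) h := by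
      rw [← map_add, sub_add_cancel]
    rw [h3]
    linarith [norm_add_le (star (Mz i ^ N) (g - h)) (star (Mz i ^ N) h)]
  have : f ∈ K := by
    rw [eq_top_of_mono_mem hK]
    · trivial
    intro k
    refine tendsto_const_nhds.congr' ?_
    filter_upwards [Filter.eventually_gt_atTop (k i)] with N hN
    ext m
    rw [adjoint_shift_pow_apply hMz, mono_apply, if_neg]
    · rfl
    · rintro rfl
      simp at hN
  exact this

/-- A closed subspace containing `1` and invariant under the shifts is everything. -/
lemma eq_top_of_shift_invariant (hMz : ∀ (i : Fin n) (f : PolyHardy n) (k : Fin n → ℕ),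
      Mz i f k = if k i = 0 then 0 else f (Function.update k i (k i - 1)))
    {K : Submodule ℂ (PolyHardy n)} (hK : IsClosed (K : Set (PolyHardy n)))
    (h0 : mono 0 ∈ K) (hs : ∀ i, ∀ f ∈ K, Mz i f ∈ K) : K = ⊤ := by
  refine eq_top_of_mono_mem hK fun k => ?_
  induction hd : ∑ i, k i generalizing k with
  | zero =>
    have : k = 0 := by
      ext i
      exact (Finset.sum_eq_zero_iff.1 hd) i (Finset.mem_univ i)
    rwa [this]
  | succ d ih =>
    obtain ⟨i, hi⟩ : ∃ i, k i ≠ 0 := by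
      by_contra! h
      simp [h] at hd
    have h1 : mono k = Mz i (mono (Function.update k i (k i - 1))) := by
      rw [shift_mono hMz]
      congr 1
      simp [Nat.sub_add_cancel (Nat.one_le_iff_ne_zero.2 hi)]
    rw [h1]
    refine hs i _ (ih _ ?_)
    rw [Finset.sum_update_of_mem (Finset.mem_univ i)]
    rw [← Finset.add_sum_erase _ _ (Finset.mem_univ i)] at hd
    rw [← Finset.erase_eq]
    omega

/-- The Taylor series of a function in the Hardy space. -/
noncomputable def taylor : PolyHardy n →ₗ[ℂ] MvPowerSeries (Fin n) ℂ where
  toFun f := fun k => f k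
  map_add' _ _ := rfl
  map_smul' _ _ := rfl

lemma coeff_taylor (f : PolyHardy n) (m : Fin n →₀ ℕ) :
    MvPowerSeries.coeff m (taylor f) = f m := rfl

lemma taylor_injective : Function.Injective (taylor (n := n)) := by
  intro f g h
  ext k
  have := congrArg (MvPowerSeries.coeff (Finsupp.equivFunOnFinite.symm k)) h
  simpa [coeff_taylor] using this

lemma taylor_shift (hMz : ∀ (i : Fin n) (f : PolyHardy n) (k : Fin n → ℕ),
      Mz i f k = if k i = 0 then 0 else f (Function.update k i (k i - 1))) (i : Fin n)
    (f : PolyHardy n) : taylor (Mz i f) = MvPowerSeries.X i * taylor f := by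
  classical
  ext m
  rw [coeff_taylor, hMz, MvPowerSeries.X, MvPowerSeries.coeff_monomial_mul]
  by_cases h : m i = 0
  · rw [if_pos h, if_neg]
    simp [h]
  · rw [if_neg h, if_pos (by simp; omega), one_mul, coeff_taylor]
    refine congrArg (f : (Fin n → ℕ) → ℂ) ?_
    ext j
    rcases eq_or_ne j i with rfl | hj
    · simp
    · simp [hj]

lemma taylor_one : taylor (mono 0 : PolyHardy n) = 1 := by
  classical
  ext m
  rw [coeff_taylor, mono_apply, MvPowerSeries.coeff_one]
  congr 1
  simp

/-- An operator commuting with all the shifts is a multiplication operator. -/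
lemma taylor_commutant (hMz : ∀ (i : Fin n) (f : PolyHardy n) (k : Fin n → ℕ),
      Mz i f k = if k i = 0 then 0 else f (Function.update k i (k i - 1)))
    (T : PolyHardy n →L[ℂ] PolyHardy n) (hT : ∀ i g, T (Mz i g) = Mz i (T g)) (g : PolyHardy n) :
    taylor (T g) = taylor g * taylor (T (mono 0)) := by
  let K : Submodule ℂ (PolyHardy n) :=
    { carrier := {g | taylor (T g) = taylor g * taylor (T (mono 0))}
      add_mem' := fun {a b} (ha : _ = _) (hb : _ = _) => by
        simp only [Set.mem_ofPred_eq, map_add, ha, hb, add_mul]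
      zero_mem' := by simp
      smul_mem' := fun c x (hx : _ = _) => by
        simp only [Set.mem_ofPred_eq, map_smul, hx, smul_mul_assoc] }
  have hK : IsClosed (K : Set (PolyHardy n)) := by
    have : (K : Set (PolyHardy n)) = ⋂ m, {g | MvPowerSeries.coeff m (taylor (T g)) =
        MvPowerSeries.coeff m (taylor g * taylor (T (mono 0)))} := by
      ext g
      simp only [Set.mem_iInter, Set.mem_ofPred_eq]
      exact MvPowerSeries.ext_iff
    rw [this]
    refine isClosed_iInter fun m => isClosed_eq ?_ ?_
    · exact (continuous_coeff m).comp T.continuous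
    · simp_rw [MvPowerSeries.coeff_mul, coeff_taylor]
      exact continuous_finsetSum _ fun a _ => (continuous_coeff _).mul continuous_const
  have : K = ⊤ := by
    refine eq_top_of_shift_invariant hMz hK ?_ ?_
    · change taylor (T (mono 0)) = _
      rw [taylor_one, one_mul]
    · intro i f (hf : _ = _)
      change taylor (T (Mz i f)) = _
      rw [hT, taylor_shift hMz, hf, taylor_shift hMz, mul_assoc]
  have hg : g ∈ K := by
    rw [this]
    trivial
  exact hg

end Shift

section Compression

variable {E : Type*} [NormedAddCommGroup E] [InnerProductSpace ℂ E]

lemma finiteDimensional_range_add {A B : E →L[ℂ] E} (hA : FiniteDimensional ℂ A.range)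
    (hB : FiniteDimensional ℂ B.range) : FiniteDimensional ℂ (A + B).range := by
  refine Submodule.finiteDimensional_of_le (S₂ := A.range ⊔ B.range) ?_
  rintro _ ⟨x, rfl⟩
  exact Submodule.add_mem_sup ⟨x, rfl⟩ ⟨x, rfl⟩

lemma finiteDimensional_range_of_sub {A B : E →L[ℂ] E} (hA : FiniteDimensional ℂ A.range)
    (h : FiniteDimensional ℂ (A - B).range) : FiniteDimensional ℂ B.range := by
  refine Submodule.finiteDimensional_of_le (S₂ := A.range ⊔ (A - B).range) ?_
  rintro _ ⟨x, rfl⟩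
  have hx : B x = A x - (A - B) x := (sub_sub_cancel (A x) (B x)).symm
  rw [ContinuousLinearMap.coe_coe, hx]
  exact sub_mem (Submodule.mem_sup_left ⟨x, rfl⟩) (Submodule.mem_sup_right ⟨x, rfl⟩)

lemma finiteDimensional_range_mul_left (A : E →L[ℂ] E) {B : E →L[ℂ] E}
    (hB : FiniteDimensional ℂ B.range) : FiniteDimensional ℂ (A * B).range := by
  have : (A * B).range = B.range.map (A : E →ₗ[ℂ] E) := LinearMap.range_comp _ _
  rw [this]
  infer_instance

lemma finiteDimensional_range_mul_right {A : E →L[ℂ] E} (B : E →L[ℂ] E)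
    (hA : FiniteDimensional ℂ A.range) : FiniteDimensional ℂ (A * B).range :=
  Submodule.finiteDimensional_of_le (S₂ := A.range) (LinearMap.range_comp_le_range _ _)

variable (S : Submodule ℂ E) [CompleteSpace S]

/-- The compression of an operator to a complete subspace. -/
noncomputable def compr (X : E →L[ℂ] E) : S →L[ℂ] S :=
  S.orthogonalProjectionOnto ∘L (X ∘L S.subtypeL)

lemma compr_add (X Y : E →L[ℂ] E) : compr S (X + Y) = compr S X + compr S Y := by
  ext x
  simp [compr]

lemma compr_sub (X Y : E →L[ℂ] E) : compr S (X - Y) = compr S X - compr S Y := by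
  ext x
  simp [compr]

lemma compr_one : compr S 1 = 1 := by
  ext x
  simp [compr]

lemma compr_algebraMap (c : ℂ) : compr S (algebraMap ℂ _ c) = algebraMap ℂ _ c := by
  ext x
  simp [compr, Algebra.algebraMap_eq_smul_one]

lemma compr_star [CompleteSpace E] (X : E →L[ℂ] E) : compr S (star X) = star (compr S X) := by
  simp only [compr, star_eq_adjoint, adjoint_comp, Submodule.adjoint_subtypeL,
    Submodule.adjoint_orthogonalProjectionOnto, ContinuousLinearMap.comp_assoc]

lemma continuous_compr : Continuous (compr S) :=
  continuous_const.clm_comp (continuous_id.clm_comp continuous_const)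

/-- Compression to a subspace of finite codimension is multiplicative up to finite rank. -/
lemma finiteDimensional_range_compr_mul [FiniteDimensional ℂ Sᗮ] (X Y : E →L[ℂ] E) :
    FiniteDimensional ℂ (compr S (X * Y) - compr S X * compr S Y).range := by
  let F : Sᗮ →L[ℂ] S := S.orthogonalProjectionOnto ∘L (X ∘L Sᗮ.subtypeL)
  let G : S →L[ℂ] Sᗮ := Sᗮ.orthogonalProjectionOnto ∘L (Y ∘L S.subtypeL)
  have : compr S (X * Y) - compr S X * compr S Y = F ∘L G := by
    ext x
    have h := S.starProjection_add_starProjection_orthogonal (Y x)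
    have h2 : X (Y x) - X (S.starProjection (Y x)) = X (Sᗮ.starProjection (Y x)) := by
      rw [sub_eq_iff_eq_add', ← map_add, h]
    have h3 := congrArg (fun y => (S.orthogonalProjectionOnto y : E)) h2
    simp only [map_sub] at h3
    exact h3
  rw [this]
  exact Submodule.finiteDimensional_of_le (S₂ := F.range) (LinearMap.range_comp_le_range _ _)

lemma compr_mem_of_mem_closure_adjoin [CompleteSpace E] [FiniteDimensional ℂ Sᗮ] {R : Set (E →L[ℂ] E)}
    {B : StarSubalgebra ℂ (S →L[ℂ] S)} (hB : IsClosed (B : Set (S →L[ℂ] S)))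
    (hfin : ∀ T : S →L[ℂ] S, FiniteDimensional ℂ T.range → T ∈ B)
    (hR : ∀ r ∈ R, compr S r ∈ B) {X : E →L[ℂ] E}
    (hX : X ∈ (StarAlgebra.adjoin ℂ R).topologicalClosure) : compr S X ∈ B := by
  have hcl : IsClosed {X | compr S X ∈ B} := hB.preimage (continuous_compr S)
  refine hcl.closure_subset_iff.2 ?_ hX
  intro Y hY
  refine StarAlgebra.adjoin_induction (p := fun Y _ => compr S Y ∈ B) hR ?_ ?_ ?_ ?_ hY
  · intro c
    rw [compr_algebraMap]
    exact algebraMap_mem B c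
  · intro x y _ _ hx hy
    rw [compr_add]
    exact add_mem hx hy
  · intro x y _ _ hx hy
    rw [← sub_add_cancel (compr S (x * y)) (compr S x * compr S y)]
    exact add_mem (hfin _ (finiteDimensional_range_compr_mul S x y)) (mul_mem hx hy)
  · intro x _ hx
    rw [compr_star]
    exact star_mem hx

lemma finiteDimensional_range_compr_list_prod [FiniteDimensional ℂ Sᗮ] {ι : Type*} (l : List ι)
    (a : ι → E →L[ℂ] E) (α : ι → S →L[ℂ] S)
    (h : ∀ i, FiniteDimensional ℂ (compr S (a i) - α i).range) :
    FiniteDimensional ℂ (compr S (l.map a).prod - (l.map α).prod).range := by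
  induction l with
  | nil =>
    have : compr S (List.map a []).prod - (List.map α []).prod = 0 := by simp [compr_one]
    rw [this]
    exact Submodule.finiteDimensional_of_le (S₂ := ⊥) (by rintro _ ⟨x, rfl⟩; simp)
  | cons i l ih =>
    have : compr S ((i :: l).map a).prod - ((i :: l).map α).prod =
        (compr S (a i * (l.map a).prod) - compr S (a i) * compr S (l.map a).prod) +
        ((compr S (a i) - α i) * compr S (l.map a).prod +
          α i * (compr S (l.map a).prod - (l.map α).prod)) := by
      rw [List.map_cons, List.prod_cons, List.map_cons, List.prod_cons, sub_mul, mul_sub]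
      abel
    rw [this]
    exact finiteDimensional_range_add (finiteDimensional_range_compr_mul S _ _)
      (finiteDimensional_range_add (finiteDimensional_range_mul_right _ (h i))
        (finiteDimensional_range_mul_left _ ih))

end Compression

section Restriction

variable {n : ℕ} {Mz : Fin n → (PolyHardy n →L[ℂ] PolyHardy n)}
  {S : Submodule ℂ (PolyHardy n)} [CompleteSpace S]

lemma coe_compr_of_invariant {E : Type*} [NormedAddCommGroup E] [InnerProductSpace ℂ E]
    (S : Submodule ℂ E) [CompleteSpace S] {X : E →L[ℂ] E}
    (h : ∀ x ∈ S, X x ∈ S) (x : S) : (compr S X x : E) = X x :=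
  Submodule.starProjection_eq_self_iff.2 (h x x.2)

lemma pow_apply_mem {E : Type*} [NormedAddCommGroup E] [InnerProductSpace ℂ E]
    {S : Submodule ℂ E} {X : E →L[ℂ] E} (h : ∀ x ∈ S, X x ∈ S) (N : ℕ) :
    ∀ x ∈ S, (X ^ N) x ∈ S := by
  induction N with
  | zero => exact fun x hx => hx
  | succ N ih => exact fun x hx => by rw [pow_succ']; exact h _ (ih x hx)

lemma compr_pow_of_invariant {E : Type*} [NormedAddCommGroup E] [InnerProductSpace ℂ E]
    (S : Submodule ℂ E) [CompleteSpace S] {X : E →L[ℂ] E}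
    (h : ∀ x ∈ S, X x ∈ S) (N : ℕ) : compr S (X ^ N) = compr S X ^ N := by
  induction N with
  | zero => exact compr_one S
  | succ N ih =>
    ext x
    rw [coe_compr_of_invariant S (pow_apply_mem h _), pow_succ', pow_succ', mul_apply_eq_comp,
      mul_apply_eq_comp, coe_compr_of_invariant S h, ← ih,
      coe_compr_of_invariant S (pow_apply_mem h _)]

open Polynomial in
lemma coe_aeval_compr {E : Type*} [NormedAddCommGroup E] [InnerProductSpace ℂ E]
    (S : Submodule ℂ E) [CompleteSpace S] {X : E →L[ℂ] E}
    (h : ∀ x ∈ S, X x ∈ S) (p : ℂ[X]) (x : S) : (aeval (compr S X) p x : E) = aeval X p x := by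
  induction p using Polynomial.induction_on' with
  | add p q hp hq =>
    rw [map_add, map_add, add_apply, add_apply, Submodule.coe_add, hp, hq]
  | monomial k a =>
    rw [aeval_monomial, aeval_monomial, Algebra.algebraMap_eq_smul_one,
      Algebra.algebraMap_eq_smul_one, smul_mul_assoc, smul_mul_assoc, one_mul, one_mul,
      ← compr_pow_of_invariant S h, smul_apply, smul_apply, Submodule.coe_smul,
      coe_compr_of_invariant S (pow_apply_mem h _)]

lemma tendsto_list_prod_apply {E ι : Type*} [NormedAddCommGroup E] [NormedSpace ℂ E]
    (l : List ι) (a : ι → ℕ → E →L[ℂ] E) (C : ℝ) (hC : ∀ i N, ‖a i N‖ ≤ C)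
    (ha : ∀ i x, Filter.Tendsto (fun N => a i N x) Filter.atTop (nhds x)) (x : E) :
    Filter.Tendsto (fun N => (l.map fun i => a i N).prod x) Filter.atTop (nhds x) := by
  induction l with
  | nil => simp
  | cons i l ih =>
    simp only [List.map_cons, List.prod_cons, mul_apply_eq_comp]
    have h1 : Filter.Tendsto (fun N => a i N ((l.map fun i => a i N).prod x - x)) Filter.atTop
        (nhds 0) := by
      have h2 : Filter.Tendsto (fun N => C * ‖(l.map fun i => a i N).prod x - x‖) Filter.atTop
          (nhds 0) := by
        simpa using (tendsto_iff_norm_sub_tendsto_zero.1 ih).const_mul C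
      exact squeeze_zero_norm (fun N => le_of_opNorm_le _ (hC i N) _) h2
    simpa using h1.add (ha i x)

/-- The `C^*`-algebra of an invariant subspace of finite codimension contains a nonzero operator
of finite rank. -/
lemma exists_finite_rank_mem (hMz : ∀ (i : Fin n) (f : PolyHardy n) (k : Fin n → ℕ),
      Mz i f k = if k i = 0 then 0 else f (Function.update k i (k i - 1)))
    (hinv : ∀ (i : Fin n), ∀ x ∈ S, Mz i x ∈ S) [FiniteDimensional ℂ Sᗮ]
    {B : StarSubalgebra ℂ (S →L[ℂ] S)} (hB : ∀ i, compr S (Mz i) ∈ B)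
    {x : S} (hx : x ≠ 0) :
    ∃ a ∈ B, a ≠ 0 ∧ FiniteDimensional ℂ a.range := by
  let α : Fin n → ℕ → S →L[ℂ] S := fun i N => 1 - compr S (Mz i) ^ N * star (compr S (Mz i) ^ N)
  have hstar (i N) : star (compr S (Mz i) ^ N) = compr S (star (Mz i ^ N)) := by
    rw [compr_star, compr_pow_of_invariant S (hinv i)]
  have hnorm (i N) : ‖star (compr S (Mz i) ^ N)‖ ≤ 1 := by
    refine ContinuousLinearMap.opNorm_le_bound _ zero_le_one fun y => ?_
    rw [hstar]
    exact (S.norm_orthogonalProjectionOnto_apply_le _).trans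
      (le_of_opNorm_le _ (norm_star_shift_pow_le hMz i N) _)
  have hnorm' (i N) : ‖compr S (Mz i) ^ N‖ ≤ 1 := by
    have := hnorm i N
    rwa [star_eq_adjoint, LinearIsometryEquiv.norm_map] at this
  have hlim : ∀ i (y : S), Filter.Tendsto (fun N => α i N y) Filter.atTop (nhds y) := by
    intro i y
    have h1 : Filter.Tendsto (fun N => star (compr S (Mz i) ^ N) y) Filter.atTop (nhds 0) := by
      simp_rw [hstar]
      have := (S.orthogonalProjectionOnto.continuous.tendsto 0).comp
        (tendsto_star_shift_pow hMz i (y : PolyHardy n))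
      rw [map_zero] at this
      exact this
    have h2 : Filter.Tendsto (fun N => (compr S (Mz i) ^ N) (star (compr S (Mz i) ^ N) y))
        Filter.atTop (nhds 0) := by
      refine squeeze_zero_norm (fun N => ?_) (tendsto_norm_zero.comp h1)
      exact (le_of_opNorm_le _ (hnorm' i N) _).trans_eq (one_mul _)
    have h3 : Filter.Tendsto (fun N => y - (compr S (Mz i) ^ N) (star (compr S (Mz i) ^ N) y))
        Filter.atTop (nhds y) := by
      simpa only [sub_zero] using tendsto_const_nhds.sub h2
    exact h3
  have hC : ∀ i N, ‖α i N‖ ≤ 2 := by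
    intro i N
    refine ContinuousLinearMap.opNorm_le_bound _ zero_le_two fun y => ?_
    have h1 : ‖(compr S (Mz i) ^ N) (star (compr S (Mz i) ^ N) y)‖ ≤ ‖y‖ := by
      refine ((le_of_opNorm_le _ (hnorm' i N) _).trans_eq (one_mul _)).trans ?_
      exact (le_of_opNorm_le _ (hnorm i N) _).trans_eq (one_mul _)
    have h2 := norm_sub_le y ((compr S (Mz i) ^ N) (star (compr S (Mz i) ^ N) y))
    refine h2.trans ?_
    linarith
  have hne := (tendsto_list_prod_apply (List.finRange n) α 2 hC hlim x).eventually_ne hx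
  obtain ⟨N, hN⟩ := hne.exists
  refine ⟨((List.finRange n).map fun i => α i N).prod, ?_, ?_, ?_⟩
  · refine list_prod_mem fun b hb => ?_
    obtain ⟨i, _, rfl⟩ := List.mem_map.1 hb
    have := pow_mem (hB i) N
    exact sub_mem (one_mem _) (mul_mem this (star_mem this))
  · intro h
    rw [h] at hN
    exact hN rfl
  · have h1 := finiteDimensional_range_compr_list_prod S (List.finRange n)
      (fun i => 1 - Mz i ^ N * star (Mz i ^ N)) (fun i => α i N) (fun i => by
        have := finiteDimensional_range_compr_mul S (Mz i ^ N) (star (Mz i ^ N))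
        have h2 : compr S (1 - Mz i ^ N * star (Mz i ^ N)) - α i N =
            (-1) * (compr S (Mz i ^ N * star (Mz i ^ N)) -
              compr S (Mz i ^ N) * compr S (star (Mz i ^ N))) := by
          simp only [α]
          rw [compr_sub, compr_one, hstar, ← compr_pow_of_invariant S (hinv i)]
          refine ContinuousLinearMap.ext fun y => ?_
          exact (sub_sub_sub_cancel_left _ _ y).trans (neg_sub _ _).symm
        rw [h2]
        exact finiteDimensional_range_mul_left _ this)
    have h2 : FiniteDimensional ℂ (compr S ((List.finRange n).map
        fun i => 1 - Mz i ^ N * star (Mz i ^ N)).prod).range := by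
      have hbox := finiteDimensional_range_box hMz N
      set Q := ((List.finRange n).map fun i => 1 - Mz i ^ N * star (Mz i ^ N)).prod
      refine Submodule.finiteDimensional_of_le (S₂ := Q.range.map
        (S.orthogonalProjectionOnto : PolyHardy n →ₗ[ℂ] S)) ?_
      rintro _ ⟨y, rfl⟩
      exact ⟨Q y, ⟨y, rfl⟩, rfl⟩
    exact finiteDimensional_range_of_sub h2 h1

open Polynomial in
lemma commute_aeval {A : Type*} [Ring A] [Algebra ℂ A] {x y : A} (h : Commute x y) (p : ℂ[X]) :
    Commute x (aeval y p) := by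
  induction p using Polynomial.induction_on with
  | C a =>
    rw [aeval_C]
    exact (Algebra.commutes a x).symm
  | add p q hp hq =>
    rw [map_add]
    exact hp.add_right hq
  | monomial k a _ =>
    rw [map_mul, aeval_C, map_pow, aeval_X]
    exact Commute.mul_right (show Commute x _ from (Algebra.commutes a x).symm) (h.pow_right _)

open Polynomial in
lemma aeval_shift_coeff (hMz : ∀ (i : Fin n) (f : PolyHardy n) (k : Fin n → ℕ),
      Mz i f k = if k i = 0 then 0 else f (Function.update k i (k i - 1))) (i : Fin n)
    (p : ℂ[X]) (j : ℕ) : (aeval (Mz i) p) (mono 0) (Pi.single i j) = p.coeff j := by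
  induction p using Polynomial.induction_on' with
  | add p q hp hq => rw [map_add, coeff_add, ← hp, ← hq]; rfl
  | monomial k a =>
    rw [aeval_monomial, Algebra.algebraMap_eq_smul_one, smul_mul_assoc, one_mul]
    change a * (Mz i ^ k) (mono 0) (Pi.single i j) = _
    have : (Function.update (0 : Fin n → ℕ) i k = Pi.single i k) := rfl
    rw [shift_pow_mono hMz, mono_apply, coeff_monomial, Pi.zero_apply, zero_add, this]
    have h2 : (Pi.single i j : Fin n → ℕ) = Pi.single i k ↔ k = j :=
      ⟨fun h => (Pi.single_injective i h).symm, fun h => h ▸ rfl⟩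
    simp only [h2, mul_ite, mul_one, mul_zero]

open Polynomial in
/-- A subspace of finite codimension contains a nonzero polynomial in each single variable. -/
lemma exists_polynomial_mem [FiniteDimensional ℂ Sᗮ] (Mz : Fin n → (PolyHardy n →L[ℂ] PolyHardy n))
    (i : Fin n) : ∃ p : ℂ[X], p ≠ 0 ∧ (aeval (Mz i) p) (mono 0) ∈ S := by
  let L : ℂ[X] →ₗ[ℂ] Sᗮ := (Sᗮ.orthogonalProjectionOnto : PolyHardy n →ₗ[ℂ] Sᗮ) ∘ₗ
    (ContinuousLinearMap.apply ℂ (PolyHardy n) (mono 0)).toLinearMap ∘ₗ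
    (aeval (Mz i)).toLinearMap
  have hL : ¬ Function.Injective L := fun h =>
    Polynomial.not_finite (R := ℂ) (Module.Finite.of_injective L h)
  rw [← LinearMap.ker_eq_bot, Submodule.eq_bot_iff] at hL
  push Not at hL
  obtain ⟨p, hp, hp0⟩ := hL
  refine ⟨p, hp0, ?_⟩
  have h1 : (aeval (Mz i) p) (mono 0) ∈ Sᗮᗮ :=
    Submodule.orthogonalProjectionOnto_eq_zero_iff.1 hp
  rwa [Submodule.orthogonal_orthogonal] at h1

open Polynomial in
/-- The compressed shifts on an invariant subspace of finite codimension are irreducible. -/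
lemma irreducible_compr (hMz : ∀ (i : Fin n) (f : PolyHardy n) (k : Fin n → ℕ),
      Mz i f k = if k i = 0 then 0 else f (Function.update k i (k i - 1)))
    (hinv : ∀ (i : Fin n), ∀ x ∈ S, Mz i x ∈ S) {p : ℂ[X]} (hp : p ≠ 0) {j : Fin n}
    (hpS : (aeval (Mz j) p) (mono 0) ∈ S) (P : S →L[ℂ] S) (hPP : P * P = P)
    (hP : ∀ i, P * compr S (Mz i) = compr S (Mz i) * P) : P = 0 ∨ P = 1 := by
  have hS : IsClosed (S : Set (PolyHardy n)) := IsComplete.isClosed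
    (completeSpace_coe_iff_isComplete.1 inferInstance)
  set Q := aeval (Mz j) p with hQ
  have hQM (i g) : Q (Mz i g) = Mz i (Q g) :=
    (congrArg (fun T : PolyHardy n →L[ℂ] PolyHardy n => T g)
      (commute_aeval (shift_commute hMz i j) p).eq).symm
  have hQS : ∀ g, Q g ∈ S := by
    have : S.comap (Q : PolyHardy n →ₗ[ℂ] PolyHardy n) = ⊤ :=
      eq_top_of_shift_invariant hMz (hS.preimage Q.continuous) hpS fun i f hf => by
        change Q (Mz i f) ∈ S
        rw [hQM]
        exact hinv i _ hf
    intro g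
    have hg : g ∈ S.comap (Q : PolyHardy n →ₗ[ℂ] PolyHardy n) := this ▸ Submodule.mem_top
    exact hg
  have hQR : ∀ x : S, (aeval (compr S (Mz j)) p x : PolyHardy n) = Q x :=
    coe_aeval_compr S (hinv j) p
  have hPQ : ∀ x : S, P ⟨Q x, hQS x⟩ = ⟨Q (P x), hQS _⟩ := by
    intro x
    have h1 : ∀ y : S, aeval (compr S (Mz j)) p y = ⟨Q y, hQS y⟩ := fun y => Subtype.ext (hQR y)
    rw [← h1, ← h1]
    exact congrArg (fun T : S →L[ℂ] S => T x) (commute_aeval (hP j) p).eq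
  let T : PolyHardy n →L[ℂ] PolyHardy n := S.subtypeL ∘L P ∘L Q.codRestrict S hQS
  have hTM (i g) : T (Mz i g) = Mz i (T g) := by
    have h1 : P (⟨Q (Mz i g), hQS _⟩ : S) = P (compr S (Mz i) ⟨Q g, hQS g⟩) := by
      congr 1
      apply Subtype.ext
      rw [coe_compr_of_invariant S (hinv i)]
      exact hQM i g
    have h2 := congrArg (fun T : S →L[ℂ] S => T ⟨Q g, hQS g⟩) (hP i)
    have h3 : P (⟨Q (Mz i g), hQS _⟩ : S) = compr S (Mz i) (P ⟨Q g, hQS g⟩) := h1.trans h2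
    have h4 := congrArg (fun y : S => (y : PolyHardy n)) h3
    exact h4.trans (coe_compr_of_invariant S (hinv i) _)
  have key : ∀ x : S, taylor (P x : PolyHardy n) * taylor (Q (mono 0)) =
      taylor (x : PolyHardy n) * taylor (T (mono 0)) := by
    intro x
    rw [← taylor_commutant hMz T hTM, ← taylor_commutant hMz Q hQM]
    exact congrArg (fun y : S => taylor (y : PolyHardy n)) (hPQ x).symm
  have hq : taylor (Q (mono 0)) ≠ 0 := by
    intro h
    have h0 : Q (mono 0) = 0 := taylor_injective (h.trans (map_zero _).symm)
    refine hp (Polynomial.ext fun k => ?_)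
    rw [← aeval_shift_coeff hMz j, ← hQ, h0]
    rfl
  let f : S := P ⟨Q (mono 0), hQS _⟩
  have hPf : P f = f := congrArg (fun T : S →L[ℂ] S => T ⟨Q (mono 0), hQS _⟩) hPP
  have hf : T (mono 0) = f := rfl
  have hff := key f
  rw [hPf, hf] at hff
  rcases eq_or_ne (taylor (f : PolyHardy n)) 0 with h0 | h0
  · left
    ext1 x
    have := key x
    rw [hf, h0, mul_zero] at this
    exact Subtype.ext (taylor_injective (((mul_eq_zero.1 this).resolve_right hq).trans
      (map_zero _).symm))
  · right
    have h1 := mul_left_cancel₀ h0 hff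
    ext1 x
    have := key x
    rw [hf, ← h1] at this
    exact Subtype.ext (taylor_injective (mul_right_cancel₀ hq this))

end Restriction

section Toeplitz

open InnerProductSpace (rankOne)

variable {n : ℕ} {Mz : Fin n → (PolyHardy n →L[ℂ] PolyHardy n)}

lemma box_list_mem {A : StarSubalgebra ℂ (PolyHardy n →L[ℂ] PolyHardy n)} (h : ∀ i, Mz i ∈ A)
    (l : List (Fin n)) (N : ℕ) : (l.map fun i => 1 - Mz i ^ N * star (Mz i ^ N)).prod ∈ A := by
  refine list_prod_mem fun b hb => ?_
  obtain ⟨i, _, rfl⟩ := List.mem_map.1 hb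
  have := pow_mem (h i) N
  exact sub_mem (one_mem _) (mul_mem this (star_mem this))

lemma box_eq_rankOne (hMz : ∀ (i : Fin n) (f : PolyHardy n) (k : Fin n → ℕ),
      Mz i f k = if k i = 0 then 0 else f (Function.update k i (k i - 1))) :
    ((List.finRange n).map fun i => 1 - Mz i ^ 1 * star (Mz i ^ 1)).prod =
      rankOne ℂ (mono 0) (mono 0) := by
  ext f k
  rw [box_list_apply hMz, InnerProductSpace.rankOne_apply, inner_mono]
  change _ = f 0 * mono 0 k
  rw [mono_apply]
  have : (∀ i ∈ List.finRange n, k i < 1) ↔ k = 0 := by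
    simp [funext_iff]
  simp only [this]
  split_ifs with h
  · rw [h, mul_one]
  · rw [mul_zero]

/-- A closed star algebra containing the shifts contains all operators of rank one. -/
lemma rankOne_mem_of_shift_mem (hMz : ∀ (i : Fin n) (f : PolyHardy n) (k : Fin n → ℕ),
      Mz i f k = if k i = 0 then 0 else f (Function.update k i (k i - 1)))
    {A : StarSubalgebra ℂ (PolyHardy n →L[ℂ] PolyHardy n)}
    (hA : IsClosed (A : Set (PolyHardy n →L[ℂ] PolyHardy n))) (h : ∀ i, Mz i ∈ A)
    (x y : PolyHardy n) : rankOne ℂ x y ∈ A := by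
  have h1 : ∀ x : PolyHardy n, rankOne ℂ x (mono 0 : PolyHardy n) ∈ A := by
    let K : Submodule ℂ (PolyHardy n) :=
      { carrier := {x | rankOne ℂ x (mono 0 : PolyHardy n) ∈ A}
        add_mem' := fun {a b} (ha : _ ∈ A) (hb : _ ∈ A) => by
          simpa only [Set.mem_ofPred_eq, map_add, add_apply] using add_mem ha hb
        zero_mem' := by simp
        smul_mem' := fun c x (hx : _ ∈ A) => by
          simpa using A.smul_mem hx c }
    have hK : IsClosed (K : Set (PolyHardy n)) :=
      hA.preimage (f := fun x => rankOne ℂ x (mono 0 : PolyHardy n)) (by fun_prop)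
    have hK' : K = ⊤ := by
      refine eq_top_of_shift_invariant hMz hK ?_ fun i f (hf : _ ∈ A) => ?_
      · change rankOne ℂ (mono 0) (mono 0) ∈ A
        rw [← box_eq_rankOne hMz]
        exact box_list_mem h _ _
      · change rankOne ℂ (Mz i f) (mono 0) ∈ A
        rw [← InnerProductSpace.comp_rankOne]
        exact mul_mem (h i) hf
    intro x
    have : x ∈ K := hK' ▸ Submodule.mem_top
    exact this
  have h2 : rankOne ℂ x y = rankOne ℂ x (mono 0 : PolyHardy n) *
      star (rankOne ℂ y (mono 0 : PolyHardy n)) := by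
    ext1 z
    simp [star_eq_adjoint, norm_mono, InnerProductSpace.rankOne_apply]
  rw [h2]
  exact mul_mem (h1 x) (star_mem (h1 y))

/-- A star algebra containing the shifts contains an isometry whose range is the orthogonal
complement of the constants. -/
lemma exists_isometry_ker_span_one (hMz : ∀ (i : Fin n) (f : PolyHardy n) (k : Fin n → ℕ),
      Mz i f k = if k i = 0 then 0 else f (Function.update k i (k i - 1))) (i : Fin n)
    {A : StarSubalgebra ℂ (PolyHardy n →L[ℂ] PolyHardy n)} (h : ∀ i, Mz i ∈ A) :
    ∃ V ∈ A, star V * V = 1 ∧ ∀ y, star V y = 0 ↔ y ∈ Submodule.span ℂ {mono 0} := by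
  classical
  obtain ⟨D, hDA, hD⟩ : ∃ D ∈ A, ∀ (f : PolyHardy n) (k : Fin n → ℕ),
      D f k = if ∀ j, j ≠ i → k j = 0 then f k else 0 := by
    refine ⟨_, box_list_mem h ((List.finRange n).filter (· ≠ i)) 1, fun f k => ?_⟩
    rw [box_list_apply hMz]
    simp
  let V := 1 - D + Mz i * D
  have hupd (k : Fin n → ℕ) (m : ℕ) :
      (∀ j, j ≠ i → Function.update k i m j = 0) ↔ ∀ j, j ≠ i → k j = 0 :=
    forall₂_congr fun j hj => by rw [Function.update_of_ne hj]
  have hV (f : PolyHardy n) (k : Fin n → ℕ) : V f k = if ∀ j, j ≠ i → k j = 0 then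
      (if k i = 0 then 0 else f (Function.update k i (k i - 1))) else f k := by
    change f k - D f k + Mz i (D f) k = _
    rw [hMz, hD, hD]
    simp only [hupd]
    split_ifs <;> simp
  have hVm (k : Fin n → ℕ) : V (mono k) = if ∀ j, j ≠ i → k j = 0 then
      mono (Function.update k i (k i + 1)) else mono k := by
    have hDm : D (mono k) = if ∀ j, j ≠ i → k j = 0 then mono k else 0 := by
      ext m
      rw [hD, mono_apply k m]
      by_cases hmk : m = k
      · subst hmk
        rw [if_pos rfl]
        split_ifs
        · rw [mono_apply, if_pos rfl]
        · rfl
      · rw [if_neg hmk, ite_self]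
        split_ifs
        · rw [mono_apply, if_neg hmk]
        · rfl
    change mono k - D (mono k) + Mz i (D (mono k)) = _
    rw [hDm]
    split_ifs
    · rw [sub_self, zero_add, shift_mono hMz]
    · rw [sub_zero, map_zero, add_zero]
  have hVs (f : PolyHardy n) (k : Fin n → ℕ) : star V f k = if ∀ j, j ≠ i → k j = 0 then
      f (Function.update k i (k i + 1)) else f k := by
    rw [← inner_mono, star_eq_adjoint, adjoint_inner_right, hVm]
    split_ifs <;> rw [inner_mono]
  refine ⟨V, add_mem (sub_mem (one_mem _) hDA) (mul_mem (h i) hDA), ?_, fun y => ⟨fun hy => ?_, ?_⟩⟩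
  · ext f k
    rw [mul_apply_eq_comp, hVs, hV, hV]
    simp only [hupd]
    split_ifs with _ h2
    · simp at h2
    · simp
    · rfl
  · refine Submodule.mem_span_singleton.2 ⟨y 0, ?_⟩
    ext k
    change y 0 * mono 0 k = y k
    rw [mono_apply]
    split_ifs with hk
    · rw [hk, mul_one]
    · rw [mul_zero]
      by_cases hc : ∀ j, j ≠ i → k j = 0
      · have hki : k i ≠ 0 := fun h0 => hk <| funext fun j => by
          rcases eq_or_ne j i with rfl | hj
          · exact h0
          · exact hc j hj
        have h1 := hVs y (Function.update k i (k i - 1))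
        rw [hy, if_pos ((hupd k _).2 hc)] at h1
        simpa [Nat.sub_add_cancel (Nat.one_le_iff_ne_zero.2 hki)] using h1
      · have h1 := hVs y k
        rw [hy, if_neg hc] at h1
        exact h1
  · intro hy
    obtain ⟨c, rfl⟩ := Submodule.mem_span_singleton.1 hy
    ext k
    rw [hVs]
    change (if _ then c * mono 0 _ else c * mono 0 k) = 0
    rw [mono_apply, mono_apply]
    split_ifs with h1 h2 h2
    · have := congrFun h2 i
      simp at this
    · rw [mul_zero]
    · exact absurd (fun j _ => congrFun h2 j) h1
    · rw [mul_zero]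

end Toeplitz

section Isometry

open InnerProductSpace (rankOne)

variable {E : Type*} [NormedAddCommGroup E] [InnerProductSpace ℂ E] [CompleteSpace E]
  {A : StarSubalgebra ℂ (E →L[ℂ] E)}

/-- A self-adjoint unitary carrying a multiple of a given unit vector to another one. -/
lemma exists_symmetry (hA : ∀ x y, rankOne ℂ x y ∈ A) {e x : E} (he : ‖e‖ = 1) (hx : ‖x‖ = 1) :
    ∃ W ∈ A, star W = W ∧ W * W = 1 ∧ ∃ c : ℂ, c ≠ 0 ∧ W (c • e) = x := by
  obtain ⟨c, r, hr, hc, hcr⟩ : ∃ (c : ℂ) (r : ℝ), 0 ≤ r ∧ ‖c‖ = 1 ∧ inner ℂ x (c • e) = (r : ℂ) := by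
    rcases eq_or_ne (inner ℂ x e) 0 with h | h
    · exact ⟨1, 0, le_rfl, norm_one, by simp [h]⟩
    · have hn : ‖inner ℂ x e‖ ≠ 0 := norm_ne_zero_iff.2 h
      refine ⟨‖inner ℂ x e‖ / inner ℂ x e, ‖inner ℂ x e‖, norm_nonneg _, ?_, ?_⟩
      · rw [norm_div, Complex.norm_real, norm_norm, div_self hn]
      · rw [inner_smul_right, div_mul_cancel₀ _ h]
  set e' := c • e with he'
  have hne : ‖e'‖ = 1 := by rw [he', norm_smul, hc, he, one_mul]
  have hce : inner ℂ e' e' = (1 : ℂ) := by simp [inner_self_eq_norm_sq_to_K, hne]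
  have hcx : inner ℂ x x = (1 : ℂ) := by simp [inner_self_eq_norm_sq_to_K, hx]
  have hcr' : inner ℂ e' x = (r : ℂ) := by rw [← inner_conj_symm, hcr, Complex.conj_ofReal]
  have hr1 : (1 + r : ℂ) ≠ 0 := by
    exact_mod_cast (by positivity : (1 + r : ℝ) ≠ 0)
  set y := e' + x with hy
  have hye : inner ℂ y e' = (1 + r : ℂ) := by rw [hy, inner_add_left, hce, hcr]
  have hyy : inner ℂ y y = (2 * (1 + r) : ℂ) := by
    rw [hy, inner_add_left, inner_add_right, inner_add_right, hce, hcx, hcr, hcr']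
    ring
  let s : ℂ := ((1 + r : ℝ) : ℂ)⁻¹
  have hs : s * (1 + r) = 1 := by
    simp only [s]
    push_cast
    exact inv_mul_cancel₀ hr1
  have hR : rankOne ℂ y y * rankOne ℂ y y = (2 * (1 + r) : ℂ) • rankOne ℂ y y := by
    rw [← hyy]
    exact InnerProductSpace.rankOne_comp_rankOne _ _ _ _
  refine ⟨s • rankOne ℂ y y - 1, sub_mem (A.smul_mem (hA y y) s) (one_mem _), ?_, ?_, c, ?_, ?_⟩
  · rw [star_sub, star_smul, star_one]
    simp [star_eq_adjoint, s]
  · rw [sub_mul, mul_sub, mul_sub, smul_mul_smul_comm, hR, smul_smul,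
      show s * s * (2 * (1 + r)) = 2 * s by linear_combination 2 * s * hs, two_mul, add_smul]
    simp
  · rintro rfl
    simp at hc
  · change s • (inner ℂ y e' • y) - e' = x
    rw [hye, smul_smul, hs, one_smul, hy, add_sub_cancel_left]

lemma exists_isometry_ker_span_singleton (hA : ∀ x y, rankOne ℂ x y ∈ A) {e : E} (he : ‖e‖ = 1)
    {V : E →L[ℂ] E} (hVA : V ∈ A) (hV : star V * V = 1)
    (hker : ∀ y, star V y = 0 ↔ y ∈ Submodule.span ℂ {e}) {x : E} (hx : ‖x‖ = 1) :
    ∃ T ∈ A, star T * T = 1 ∧ ∀ y, star T y = 0 ↔ y ∈ Submodule.span ℂ {x} := by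
  obtain ⟨W, hWA, hWs, hWW, c, hc, hWc⟩ := exists_symmetry hA he hx
  have hWW' (z : E) : W (W z) = z := congrArg (fun T : E →L[ℂ] E => T z) hWW
  refine ⟨W * V, mul_mem hWA hVA, ?_, fun y => ?_⟩
  · rw [star_mul, hWs, mul_assoc, ← mul_assoc W, hWW, one_mul, hV]
  · rw [star_mul, hWs, mul_apply_eq_comp, hker, Submodule.mem_span_singleton,
      Submodule.mem_span_singleton]
    constructor
    · rintro ⟨a, ha⟩
      refine ⟨a * c⁻¹, ?_⟩
      rw [← hWc, ← map_smul, smul_smul, inv_mul_cancel_right₀ hc, ha, hWW']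
    · rintro ⟨a, rfl⟩
      exact ⟨a * c, by rw [map_smul, ← hWc, hWW', smul_smul]⟩

/-- If every unit vector spans the cokernel of an isometry in a star algebra, then so does every
finite-dimensional subspace. -/
lemma exists_isometry_ker_eq
    (h : ∀ x : E, ‖x‖ = 1 → ∃ T ∈ A, star T * T = 1 ∧
      ∀ y, star T y = 0 ↔ y ∈ Submodule.span ℂ {x})
    (F : Submodule ℂ E) [FiniteDimensional ℂ F] :
    ∃ T ∈ A, star T * T = 1 ∧ ∀ y, star T y = 0 ↔ y ∈ F := by
  induction hd : Module.finrank ℂ F using Nat.strong_induction_on generalizing F with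
  | _ d ih =>
    rcases eq_or_ne F ⊥ with rfl | hF
    · exact ⟨1, one_mem _, by simp, by simp⟩
    obtain ⟨v, hvF, hv⟩ : ∃ v ∈ F, ‖v‖ = 1 := by
      obtain ⟨w, hw, hw0⟩ := Submodule.exists_mem_ne_zero_of_ne_bot hF
      exact ⟨((‖w‖ : ℂ)⁻¹) • w, F.smul_mem _ hw, norm_smul_inv_norm hw0⟩
    have hvv : inner ℂ v v = (1 : ℂ) := by simp [inner_self_eq_norm_sq_to_K, hv]
    set F' := F ⊓ (Submodule.span ℂ {v})ᗮ with hF'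
    have hFF : FiniteDimensional ℂ F' := Submodule.finiteDimensional_of_le inf_le_left
    have hlt : F' < F := lt_of_le_of_ne inf_le_left fun heq => by
      have : v ∈ F' := heq ▸ hvF
      have := Submodule.mem_orthogonal_singleton_iff_inner_right.1 this.2
      rw [hvv] at this
      exact one_ne_zero this
    obtain ⟨T, hTA, hT, hTk⟩ := ih _ (hd ▸ Submodule.finrank_lt_finrank_of_lt hlt) F' rfl
    have hTT (z : E) : star T (T z) = z := congrArg (fun R : E →L[ℂ] E => R z) hT
    have hTv : T (star T v) = v := by
      have h1 : star T (v - T (star T v)) = 0 := by rw [map_sub, hTT, sub_self]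
      have h2 := Submodule.mem_orthogonal_singleton_iff_inner_left.1 ((hTk _).1 h1).2
      have h3 : inner ℂ (v - T (star T v)) (T (star T v)) = (0 : ℂ) := by
        rw [← adjoint_inner_left, ← star_eq_adjoint, h1, inner_zero_left]
      have h4 : inner ℂ (v - T (star T v)) (v - T (star T v)) = (0 : ℂ) := by
        rw [inner_sub_right, h2, h3, sub_zero]
      exact (sub_eq_zero.1 (inner_self_eq_zero.1 h4)).symm
    have hnorm : ‖star T v‖ = 1 := by
      rw [← (norm_map_iff_adjoint_comp_self T).2 hT, hTv, hv]
    obtain ⟨R, hRA, hR, hRk⟩ := h _ hnorm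
    refine ⟨T * R, mul_mem hTA hRA, ?_, fun y => ?_⟩
    · rw [star_mul, mul_assoc, ← mul_assoc _ T, hT, one_mul, hR]
    · rw [star_mul, mul_apply_eq_comp, hRk, Submodule.mem_span_singleton]
      have h1 (a : ℂ) : a • star T v = star T y ↔ y - a • v ∈ F' := by
        rw [← hTk, map_sub, map_smul, sub_eq_zero, eq_comm]
      simp only [h1]
      constructor
      · rintro ⟨a, ha⟩
        rw [← sub_add_cancel y (a • v)]
        exact F.add_mem ha.1 (F.smul_mem _ hvF)
      · intro hy
        refine ⟨inner ℂ v y, F.sub_mem hy (F.smul_mem _ hvF), ?_⟩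
        refine Submodule.mem_orthogonal_singleton_iff_inner_right.2 ?_
        rw [inner_sub_right, inner_smul_right, hvv, mul_one, sub_self]

end Isometry

section ClosedAdjoin

variable {E : Type*} [NormedAddCommGroup E] [InnerProductSpace ℂ E] [CompleteSpace E]

/-- The closed star subalgebra generated by a set of operators. -/
noncomputable def closedAdjoin (R : Set (E →L[ℂ] E)) : StarSubalgebra ℂ (E →L[ℂ] E) :=
  (StarAlgebra.adjoin ℂ R).topologicalClosure

lemma isClosed_closedAdjoin (R : Set (E →L[ℂ] E)) :
    IsClosed (closedAdjoin R : Set (E →L[ℂ] E)) :=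
  StarSubalgebra.isClosed_topologicalClosure _

lemma mem_closedAdjoin {R : Set (E →L[ℂ] E)} {r : E →L[ℂ] E} (hr : r ∈ R) : r ∈ closedAdjoin R :=
  StarSubalgebra.le_topologicalClosure _ (StarAlgebra.subset_adjoin ℂ R hr)

lemma closedAdjoin_le {R : Set (E →L[ℂ] E)} {D : StarSubalgebra ℂ (E →L[ℂ] E)}
    (hD : IsClosed (D : Set (E →L[ℂ] E))) (h : R ⊆ D) : closedAdjoin R ≤ D :=
  StarSubalgebra.topologicalClosure_minimal (StarAlgebra.adjoin_le h) hD

end ClosedAdjoin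

lemma exists_unitary_of_isometry {E : Type*} [NormedAddCommGroup E] [InnerProductSpace ℂ E]
    [CompleteSpace E] (S : Submodule ℂ E) [CompleteSpace S] {V : E →L[ℂ] E} (hV : star V * V = 1)
    (hker : ∀ y, star V y = 0 ↔ y ∈ Sᗮ) :
    ∃ U : S ≃ₗᵢ[ℂ] E, (∀ x, U x = star V x) ∧ ∀ f, (U.symm f : E) = V f := by
  have hVV (f : E) : star V (V f) = f := congrArg (fun R : E →L[ℂ] E => R f) hV
  have hVS (f : E) : V f ∈ S := by
    rw [← S.orthogonal_orthogonal]
    intro w hw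
    rw [← adjoint_inner_left, ← star_eq_adjoint, (hker w).2 hw, inner_zero_left]
  have hSV (x : E) (hx : x ∈ S) : V (star V x) = x := by
    have h1 : x - V (star V x) ∈ Sᗮ := (hker _).1 (by rw [map_sub, hVV, sub_self])
    exact (sub_eq_zero.1 (S.inf_orthogonal_eq_bot.le ⟨S.sub_mem hx (hVS _), h1⟩)).symm
  let U : S ≃ₗ[ℂ] E :=
    { toFun := fun x => star V x
      invFun := fun f => ⟨V f, hVS f⟩
      map_add' := fun x y => map_add (star V) _ _
      map_smul' := fun c x => map_smul (star V) _ _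
      left_inv := fun x => Subtype.ext (hSV x x.2)
      right_inv := hVV }
  refine ⟨⟨U, fun x => ?_⟩, fun _ => rfl, fun _ => rfl⟩
  change ‖star V (x : E)‖ = ‖(x : E)‖
  rw [← (norm_map_iff_adjoint_comp_self V).2 hV, hSV x x.2]

lemma conj_compr {E : Type*} [NormedAddCommGroup E] [InnerProductSpace ℂ E]
    [CompleteSpace E] (S : Submodule ℂ E) [CompleteSpace S] {V : E →L[ℂ] E}
    (hker : ∀ y, star V y = 0 ↔ y ∈ Sᗮ) {U : S ≃ₗᵢ[ℂ] E} (hU : ∀ x, U x = star V x)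
    (hU' : ∀ f, (U.symm f : E) = V f) (X : E →L[ℂ] E) :
    U.conjStarAlgEquiv (compr S X) = star V * X * V := by
  ext1 f
  change U (S.orthogonalProjectionOnto (X (U.symm f : E))) = star V (X (V f))
  rw [hU, hU']
  have h1 : star V (X (V f) - S.starProjection (X (V f))) = 0 :=
    (hker _).2 (S.sub_starProjection_mem_orthogonal _)
  rw [map_sub, sub_eq_zero] at h1
  exact h1.symm

/-- If `S` is an invariant subspace of finite codimension in `H²(𝔻ⁿ)`, then `T(S)` and
`T(H²(𝔻ⁿ))` are unitarily equivalent: `U T(S) U⁻¹ = T(H²(𝔻ⁿ))` for some unitary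
`U : S → H²(𝔻ⁿ)`. -/
theorem stmt17 {n : ℕ} (hn : 2 ≤ n)
    (Mz : Fin n → (PolyHardy n →L[ℂ] PolyHardy n))
    (hMz : ∀ (i : Fin n) (f : PolyHardy n) (k : Fin n → ℕ),
      Mz i f k = if k i = 0 then 0 else f (Function.update k i (k i - 1)))
    (S : Submodule ℂ (PolyHardy n)) (hS : IsClosed (S : Set (PolyHardy n)))
    (hinv : ∀ (i : Fin n), ∀ x ∈ S, Mz i x ∈ S)
    (hcodim : FiniteDimensional ℂ ↥Sᗮ) :
    ∃ U : ↥S ≃ₗᵢ[ℂ] PolyHardy n,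
      (fun T : ↥S →L[ℂ] ↥S =>
          ((U.toContinuousLinearEquiv : ↥S →L[ℂ] PolyHardy n) ∘L T) ∘L
            (U.symm.toContinuousLinearEquiv : PolyHardy n →L[ℂ] ↥S)) ''
          TalgGen S hS (fun i => compressS S hS (Mz i))
        = TalgFull Mz := by

  have : CompleteSpace S := hS.completeSpace_coe
  let i₀ : Fin n := ⟨0, by omega⟩
  let A := closedAdjoin (Set.range Mz)
  let B := closedAdjoin (Set.range fun i => compr S (Mz i))
  have hA : IsClosed (A : Set (PolyHardy n →L[ℂ] PolyHardy n)) := isClosed_closedAdjoin _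
  have hB : IsClosed (B : Set (S →L[ℂ] S)) := isClosed_closedAdjoin _
  have hMA (i) : Mz i ∈ A := mem_closedAdjoin ⟨i, rfl⟩
  have hMB (i) : compr S (Mz i) ∈ B := mem_closedAdjoin ⟨i, rfl⟩
  obtain ⟨p, hp, hpS⟩ := exists_polynomial_mem (S := S) Mz i₀
  have hp0 : (⟨_, hpS⟩ : S) ≠ 0 := by
    intro h
    have h0 : (Polynomial.aeval (Mz i₀) p) (mono 0) = 0 := congrArg Subtype.val h
    refine hp (Polynomial.ext fun k => ?_)
    rw [← aeval_shift_coeff hMz i₀, h0]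
    rfl
  have hrankB := rankOne_mem_of_irreducible hB
    (fun P hPP hPB => irreducible_compr hMz hinv hp hpS P hPP fun i => hPB _ (hMB i))
    (exists_finite_rank_mem hMz hinv hMB hp0)
  obtain ⟨V₀, hV₀A, hV₀, hV₀k⟩ := exists_isometry_ker_span_one hMz i₀ hMA
  obtain ⟨V, hVA, hV, hVk⟩ := exists_isometry_ker_eq
    (fun x hx => exists_isometry_ker_span_singleton (rankOne_mem_of_shift_mem hMz hA hMA)
      (norm_mono 0) hV₀A hV₀ hV₀k hx) Sᗮ
  obtain ⟨U, hU, hU'⟩ := exists_unitary_of_isometry S hV hVk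
  refine ⟨U, ?_⟩
  change U.conjStarAlgEquiv '' (B : Set (S →L[ℂ] S)) = A
  have hconj := conj_compr S hVk hU hU'
  refine Set.Subset.antisymm (Set.image_subset_iff.2 ?_) fun Y hY => ?_
  · have hcont : Continuous fun T : S →L[ℂ] S => U.conjStarAlgEquiv T :=
      continuous_const.clm_comp (continuous_id.clm_comp continuous_const)
    let Ψ : (S →L[ℂ] S) →⋆ₐ[ℂ] (PolyHardy n →L[ℂ] PolyHardy n) := U.conjStarAlgEquiv
    refine closedAdjoin_le (D := A.comap Ψ) (hA.preimage hcont) ?_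
    rintro _ ⟨i, rfl⟩
    change U.conjStarAlgEquiv (compr S (Mz i)) ∈ A
    rw [hconj]
    exact mul_mem (mul_mem (star_mem hVA) (hMA i)) hVA
  · refine ⟨compr S (V * Y * star V), compr_mem_of_mem_closure_adjoin S hB
      (mem_of_finiteDimensional_range hrankB) ?_ (mul_mem (mul_mem hVA hY) (star_mem hVA)), ?_⟩
    · rintro _ ⟨i, rfl⟩
      exact hMB i
    · rw [hconj]
      calc star V * (V * Y * star V) * V = (star V * V) * Y * (star V * V) := by
            simp only [mul_assoc]
        _ = Y := by rw [hV, one_mul, mul_one]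
end
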